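/- arXiv:2112.07739 — 5 statements merged into one kernel-verified Lean document; each statement's English description precedes it below -/
import Mathlib

section
/- Let m ≥ 1 and let g be real with 0 < g < 1/4, and set z = √(1−4g). Then the functions defined by the recursion X_1(g) = g and X_{m+1}(g) = g/(1 − X_m(g)) are given explicitly by X_m(g) = 2g · ((1+z)^m − (1−z)^m) / ((1+z)^{m+1} − (1−z)^{m+1}) (in particular all the denominators occurring are nonzero). -/
/-- The functions `X_m` defined by the recursion `X₀(g) = 0`, `X_{m+1}(g) = g / (1 - X_m(g))`
(so that `X₁(g) = g`). -/
noncomputable def X : ℕ → ℝ → ℝ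
  | 0, _ => 0
  | m + 1, g => g / (1 - X m g)

theorem one_add_pow_sub_one_sub_pow_pos {z : ℝ} (hz0 : 0 < z) (hz1 : z < 1) (m : ℕ) :
    0 < (1 + z) ^ (m + 1) - (1 - z) ^ (m + 1) :=
  sub_pos.2 (pow_lt_pow_left₀ (by linarith) (by linarith) m.succ_ne_zero)

theorem one_sub_X_of_formula {g z : ℝ} (hz0 : 0 < z) (hz1 : z < 1) (hgz : 4 * g = 1 - z ^ 2)
    {m : ℕ} (h : X m g = 2 * g * ((1 + z) ^ m - (1 - z) ^ m) /
      ((1 + z) ^ (m + 1) - (1 - z) ^ (m + 1))) :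
    1 - X m g = ((1 + z) ^ (m + 2) - (1 - z) ^ (m + 2)) /
      (2 * ((1 + z) ^ (m + 1) - (1 - z) ^ (m + 1))) := by
  have hD := (one_add_pow_sub_one_sub_pow_pos hz0 hz1 m).ne'
  obtain rfl : g = (1 - z ^ 2) / 4 := by linarith
  rw [h, eq_div_iff (mul_ne_zero two_ne_zero hD), sub_mul, mul_left_comm (_ / _), div_mul_cancel₀ _ hD]
  ring

theorem X_eq_formula {g z : ℝ} (hz0 : 0 < z) (hz1 : z < 1) (hgz : 4 * g = 1 - z ^ 2) (m : ℕ) :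
    X m g = 2 * g * ((1 + z) ^ m - (1 - z) ^ m) /
      ((1 + z) ^ (m + 1) - (1 - z) ^ (m + 1)) := by
  induction m with
  | zero => simp [X]
  | succ m ih =>
    rw [X, one_sub_X_of_formula hz0 hz1 hgz ih, div_div_eq_mul_div]
    ring

/-- For `m ≥ 1` and `0 < g < 1/4`, with `z = √(1 - 4g)`, one has the explicit formula
`X_m(g) = 2g((1+z)^m - (1-z)^m)/((1+z)^{m+1} - (1-z)^{m+1})`, all denominators occurring
being nonzero. -/
theorem explicit_formula_for_X (m : ℕ) (hm : 1 ≤ m) (g : ℝ) (hg0 : 0 < g) (hg1 : g < 1 / 4)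
    (z : ℝ) (hz : z = Real.sqrt (1 - 4 * g)) :
    1 - X m g ≠ 0 ∧
    (1 + z) ^ (m + 1) - (1 - z) ^ (m + 1) ≠ 0 ∧
    X m g = 2 * g * ((1 + z) ^ m - (1 - z) ^ m) /
      ((1 + z) ^ (m + 1) - (1 - z) ^ (m + 1)) := by
  have hz0 : 0 < z := hz ▸ Real.sqrt_pos.2 (by linarith)
  have hgz : 4 * g = 1 - z ^ 2 := by rw [hz, Real.sq_sqrt (by linarith)]; ring
  have hz1 : z < 1 := by nlinarith
  have hX := X_eq_formula hz0 hz1 hgz m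
  refine ⟨?_, (one_add_pow_sub_one_sub_pow_pos hz0 hz1 m).ne', hX⟩
  rw [one_sub_X_of_formula hz0 hz1 hgz hX]
  exact div_ne_zero (one_add_pow_sub_one_sub_pow_pos hz0 hz1 (m + 1)).ne'
    (mul_ne_zero two_ne_zero (one_add_pow_sub_one_sub_pow_pos hz0 hz1 m).ne')
end

section
/- Let m ≥ 1 and let g be real with 0 < g < 1/4, and set z = √(1−4g). With the convention X_0(g) = 0, one has X_m(g) − X_{m−1}(g) = z² / D_m(z), where D_m(z) = ((1+z)/2)·((1+z)/(1−z))^m + ((1−z)/2)·((1−z)/(1+z))^m − 1. -/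
/-- The denominator function
`D_m(z) = ((1+z)/2)((1+z)/(1-z))^m + ((1-z)/2)((1-z)/(1+z))^m - 1`. -/
noncomputable def D (m : ℕ) (z : ℝ) : ℝ :=
  (1 + z) / 2 * ((1 + z) / (1 - z)) ^ m + (1 - z) / 2 * ((1 - z) / (1 + z)) ^ m - 1

/-- Closed form of `X m (a * b)` when `a + b = 1`. -/
theorem X_mul_eq_div {a b : ℝ} (hb : 0 < b) (hba : b < a) (hab : a + b = 1) (m : ℕ) :
    X m (a * b) = a * b * (a ^ m - b ^ m) / (a ^ (m + 1) - b ^ (m + 1)) := by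
  have hpos : ∀ k : ℕ, 0 < a ^ (k + 1) - b ^ (k + 1) := fun k =>
    sub_pos.2 (pow_lt_pow_left₀ hba hb.le k.succ_ne_zero)
  induction m with
  | zero => simp [X]
  | succ m ih =>
    have h1 := (hpos m).ne'
    have h2 := (hpos (m + 1)).ne'
    have hsub : 1 - X m (a * b)
        = (a ^ (m + 1 + 1) - b ^ (m + 1 + 1)) / (a ^ (m + 1) - b ^ (m + 1)) := by
      rw [ih, eq_div_iff h1, sub_mul, div_mul_cancel₀ _ h1]
      obtain rfl : a = 1 - b := by linarith
      ring
    rw [X, hsub, div_div_eq_mul_div]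

theorem D_sub_eq_div {a b : ℝ} (ha : a ≠ 0) (hb : b ≠ 0) (hab : a + b = 1) (m : ℕ) :
    D m (a - b) = (a ^ m - b ^ m) * (a ^ (m + 1) - b ^ (m + 1)) / (a * b) ^ m := by
  have h1 : 1 + (a - b) = 2 * a := by linarith
  have h2 : 1 - (a - b) = 2 * b := by linarith
  rw [D, h1, h2, mul_div_mul_left _ _ two_ne_zero, mul_div_mul_left _ _ two_ne_zero,
    mul_div_cancel_left₀ _ two_ne_zero, mul_div_cancel_left₀ _ two_ne_zero,
    div_pow, div_pow, mul_pow]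
  obtain rfl : a = 1 - b := by linarith
  field_simp
  ring

/-- For `m ≥ 1` and `0 < g < 1/4`, with `z = √(1 - 4g)` and the convention `X₀(g) = 0`,
one has `X_m(g) - X_{m-1}(g) = z² / D_m(z)`. -/
theorem X_difference_formula (m : ℕ) (hm : 1 ≤ m) (g : ℝ) (hg0 : 0 < g) (hg1 : g < 1 / 4)
    (z : ℝ) (hz : z = Real.sqrt (1 - 4 * g)) :
    X m g - X (m - 1) g = z ^ 2 / D m z := by
  obtain ⟨n, rfl⟩ := Nat.exists_eq_add_of_le' hm
  have hz0 : 0 < z := hz ▸ Real.sqrt_pos.2 (by linarith)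
  have hz2 : z ^ 2 = 1 - 4 * g := hz ▸ Real.sq_sqrt (by linarith)
  have hz1 : z < 1 := by nlinarith
  obtain ⟨a, ha⟩ : ∃ a, a = (1 + z) / 2 := ⟨_, rfl⟩
  obtain ⟨b, hb⟩ : ∃ b, b = (1 - z) / 2 := ⟨_, rfl⟩
  have hab : a + b = 1 := by linarith
  have hb0 : 0 < b := by linarith
  have hba : b < a := by linarith
  have ha0 : 0 < a := hb0.trans hba
  obtain rfl : z = a - b := by linarith
  obtain rfl : g = a * b := by nlinarith
  have h1 : a ^ (n + 1) - b ^ (n + 1) ≠ 0 :=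
    (sub_pos.2 (pow_lt_pow_left₀ hba hb0.le n.succ_ne_zero)).ne'
  have h2 : a ^ (n + 1 + 1) - b ^ (n + 1 + 1) ≠ 0 :=
    (sub_pos.2 (pow_lt_pow_left₀ hba hb0.le (n + 1).succ_ne_zero)).ne'
  rw [Nat.add_sub_cancel, X_mul_eq_div hb0 hba hab, X_mul_eq_div hb0 hba hab,
    D_sub_eq_div ha0.ne' hb0.ne' hab, div_div_eq_mul_div, div_sub_div _ _ h2 h1,
    div_eq_div_iff (mul_ne_zero h2 h1) (mul_ne_zero h1 h2)]
  ring
end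

section
/- For every m ≥ 1 and |z| < 1 one has D_m(z) = 2m(m+1)·z²·(1 + Σ_{k≥1} b_{2k}^m (2mz)^{2k}), where the coefficients b_{2k}^m satisfy |b_{2k}^m| ≤ K for all k ≥ 1 with K = 2e², and |b_{2k}^m − 2/(2(k+1))!| ≤ L·e^{2k}/m for all 1 ≤ k ≤ m with L = 2(e³+1). -/
open Complex

/-- The denominator function
`D_m(z) = ((1+z)/2)((1+z)/(1-z))^m + ((1-z)/2)((1-z)/(1+z))^m - 1`. -/
noncomputable def Dm (m : ℕ) (z : ℂ) : ℂ :=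
  (1 + z) / 2 * ((1 + z) / (1 - z)) ^ m + (1 - z) / 2 * ((1 - z) / (1 + z)) ^ m - 1

/-- The Taylor coefficients of `((1+z)/2 ((1+z)/(1-z))^(M+1) - (1-z)/2 - (M+2) z) / ((M+1)(M+2) z²)`,
whose even part is `Dm (M+1) z / (2 (M+1)(M+2) z²)`. -/
noncomputable def halfCoeff (M N : ℕ) : ℝ :=
  ∑ i ∈ Finset.range (M + 1),
    (M.choose i : ℝ) * N.choose i * (2 ^ (i + 1) / ((i + 1) * (i + 2)))

theorem halfCoeff_eq_sum_range (M N : ℕ) :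
    halfCoeff M N = ∑ i ∈ Finset.range (N + 1),
      (M.choose i : ℝ) * N.choose i * (2 ^ (i + 1) / ((i + 1) * (i + 2))) := by
  unfold halfCoeff
  trans ∑ i ∈ Finset.range (M + N + 1),
      (M.choose i : ℝ) * N.choose i * (2 ^ (i + 1) / ((i + 1) * (i + 2)))
  · refine Finset.sum_subset (fun i hi => ?_) (fun i _ hi => ?_)
    · simp only [Finset.mem_range] at *; omega
    · rw [Nat.choose_eq_zero_of_lt (n := M) (by simp only [Finset.mem_range, not_lt] at hi; omega)]; simp
  · symm
    refine Finset.sum_subset (fun i hi => ?_) (fun i _ hi => ?_)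
    · simp only [Finset.mem_range] at *; omega
    · rw [Nat.choose_eq_zero_of_lt (n := N) (by simp only [Finset.mem_range, not_lt] at hi; omega)]; simp

theorem halfCoeff_zero (M : ℕ) : halfCoeff M 0 = 1 := by
  simp [halfCoeff_eq_sum_range]

theorem halfCoeff_nonneg (M N : ℕ) : 0 ≤ halfCoeff M N :=
  Finset.sum_nonneg fun _ _ => by positivity

theorem halfCoeff_summand_le (M N i : ℕ) :
    (M.choose i : ℝ) * N.choose i * (2 ^ (i + 1) / ((i + 1) * (i + 2))) ≤
      (2 * M : ℝ) ^ i * N.choose i := by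
  have h1 : (M.choose i : ℝ) ≤ (M : ℝ) ^ i := by exact_mod_cast Nat.choose_le_pow M i
  have h2 : (2 : ℝ) ^ (i + 1) / ((i + 1) * (i + 2)) ≤ 2 ^ i := by
    rw [div_le_iff₀ (by positivity), pow_succ]
    gcongr
    nlinarith [(Nat.cast_nonneg i : (0 : ℝ) ≤ i)]
  calc (M.choose i : ℝ) * N.choose i * (2 ^ (i + 1) / ((i + 1) * (i + 2)))
      ≤ (M : ℝ) ^ i * N.choose i * 2 ^ i := by gcongr
    _ = (2 * M : ℝ) ^ i * N.choose i := by rw [mul_pow]; ring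

theorem sum_two_mul_pow_mul_choose (M N : ℕ) :
    ∑ i ∈ Finset.range (N + 1), (2 * M : ℝ) ^ i * N.choose i = (2 * M + 1) ^ N := by
  rw [add_pow]; simp

theorem halfCoeff_le (M N : ℕ) : halfCoeff M N ≤ (2 * (M + 1)) ^ N := by
  rw [halfCoeff_eq_sum_range]
  calc _ ≤ ∑ i ∈ Finset.range (N + 1), (2 * M : ℝ) ^ i * N.choose i :=
        Finset.sum_le_sum fun i _ => halfCoeff_summand_le M N i
    _ = (2 * M + 1) ^ N := sum_two_mul_pow_mul_choose M N
    _ ≤ _ := by gcongr; linarith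

theorem one_sub_mul_div_le_pow {x a : ℝ} (hx : 0 < x) (ha : a ≤ x) (N : ℕ) :
    1 - N * a / x ≤ ((x - a) / x) ^ N := by
  have h : a / x ≤ 1 := (div_le_one hx).2 ha
  have := one_add_mul_le_pow (a := -(a / x)) (by linarith) N
  rw [sub_div, div_self hx.ne']
  calc _ = 1 + N * -(a / x) := by ring
    _ ≤ _ := this
    _ = _ := by ring

theorem sum_range_div_pow_le (M N : ℕ) :
    (∑ i ∈ Finset.range N,
      (M.choose i : ℝ) * N.choose i * (2 ^ (i + 1) / ((i + 1) * (i + 2)))) /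
        (2 * (M + 1)) ^ N ≤ N / (M + 1) := by
  have hsum := sum_two_mul_pow_mul_choose M N
  rw [Finset.sum_range_succ, Nat.choose_self, Nat.cast_one, mul_one] at hsum
  have hle := Finset.sum_le_sum fun i (_ : i ∈ Finset.range N) => halfCoeff_summand_le M N i
  have hM : (0 : ℝ) < M + 1 := by positivity
  have hb := one_sub_mul_div_le_pow (a := 1) hM (by simp) N
  have hp : (2 * M + 1 : ℝ) ^ N ≤ (2 * (M + 1)) ^ N := by gcongr; linarith
  have heq : (((M : ℝ) + 1 - 1) / (M + 1)) ^ N = (2 * M) ^ N / (2 * (M + 1)) ^ N := by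
    rw [← div_pow, mul_div_mul_left _ _ two_ne_zero, add_sub_cancel_right]
  rw [heq, mul_one] at hb
  calc _ ≤ ((2 * (M + 1) : ℝ) ^ N - (2 * M) ^ N) / (2 * (M + 1)) ^ N := by
        gcongr; linarith
    _ = 1 - (2 * M : ℝ) ^ N / (2 * (M + 1)) ^ N := by
        rw [sub_div, div_self (by positivity)]
    _ ≤ _ := by linarith

theorem choose_mul_div_pow_eq (M N : ℕ) :
    (M.choose N : ℝ) * N.choose N * (2 ^ (N + 1) / ((N + 1) * (N + 2))) / (2 * (M + 1)) ^ N =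
      2 / ((N + 2).factorial : ℝ) * (M.descFactorial N / (M + 1) ^ N) := by
  rw [Nat.descFactorial_eq_factorial_mul_choose, Nat.factorial_succ, Nat.factorial_succ,
    Nat.choose_self, mul_pow]
  push_cast
  have : (N.factorial : ℝ) ≠ 0 := by positivity
  field_simp
  ring

theorem descFactorial_div_pow_le_one (M N : ℕ) :
    (M.descFactorial N : ℝ) / (M + 1) ^ N ≤ 1 := by
  rw [div_le_one (by positivity)]
  exact_mod_cast (Nat.descFactorial_le_pow M N).trans (Nat.pow_le_pow_left (Nat.le_succ M) N)

theorem one_sub_sq_div_le_descFactorial_div_pow (M N : ℕ) :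
    1 - (N : ℝ) ^ 2 / (M + 1) ≤ (M.descFactorial N : ℝ) / (M + 1) ^ N := by
  have hM : (0 : ℝ) < M + 1 := by positivity
  rcases le_or_gt N (M + 1) with h | h
  · have hN : (N : ℝ) ≤ M + 1 := by exact_mod_cast h
    have hd : (((M + 1 - N : ℕ) : ℝ)) ^ N ≤ M.descFactorial N := by
      exact_mod_cast Nat.pow_sub_le_descFactorial M N
    rw [Nat.cast_sub h] at hd
    push_cast at hd
    calc _ = 1 - N * N / ((M : ℝ) + 1) := by ring
      _ ≤ (((M : ℝ) + 1 - N) / (M + 1)) ^ N := one_sub_mul_div_le_pow hM hN N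
      _ ≤ _ := by rw [div_pow]; gcongr
  · have hN : (M : ℝ) + 1 ≤ N := by exact_mod_cast h.le
    have h1 : (1 : ℝ) ≤ N ^ 2 / (M + 1) := by
      rw [le_div_iff₀ hM]; nlinarith [(Nat.cast_nonneg M : (0 : ℝ) ≤ M)]
    have h2 : (0 : ℝ) ≤ (M.descFactorial N : ℝ) / (M + 1) ^ N := by positivity
    linarith

theorem abs_halfCoeff_div_pow_sub_le (M N : ℕ) :
    |halfCoeff M N / (2 * (M + 1)) ^ N - 2 / ((N + 2).factorial : ℝ)| ≤
      (N + N ^ 2) / (M + 1) := by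
  rw [halfCoeff_eq_sum_range, Finset.sum_range_succ, add_div, choose_mul_div_pow_eq]
  have h1 := sum_range_div_pow_le M N
  have h0 : 0 ≤ (∑ i ∈ Finset.range N,
      (M.choose i : ℝ) * N.choose i * (2 ^ (i + 1) / ((i + 1) * (i + 2)))) /
        (2 * (M + 1)) ^ N :=
    div_nonneg (Finset.sum_nonneg fun _ _ => by positivity) (by positivity)
  have h2 := descFactorial_div_pow_le_one M N
  have h3 := one_sub_sq_div_le_descFactorial_div_pow M N
  have hc0 : 0 ≤ 2 / ((N + 2).factorial : ℝ) := by positivity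
  have hc1 : 2 / ((N + 2).factorial : ℝ) ≤ 1 := by
    rw [div_le_one (by positivity)]
    exact_mod_cast (by simpa using Nat.factorial_le (Nat.le_add_left 2 N) : 2 ≤ (N + 2).factorial)
  have hsq : (0 : ℝ) ≤ (N : ℝ) ^ 2 / (M + 1) := by positivity
  have hN : (0 : ℝ) ≤ (N : ℝ) / (M + 1) := by positivity
  generalize 2 / ((N + 2).factorial : ℝ) = c at *
  generalize (M.descFactorial N : ℝ) / (M + 1) ^ N = T at *
  rw [abs_le, add_div]
  constructor <;> nlinarith

theorem HasSum.of_forall_eq {f g : ℕ → ℂ} {a : ℂ} (h : ∀ n, f n = g n) (hg : HasSum g a) :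
    HasSum f a := by
  rwa [funext h]

theorem hasSum_choose_mul_pow (i : ℕ) {z : ℂ} (hz : ‖z‖ < 1) :
    HasSum (fun n : ℕ => (n.choose i : ℂ) * z ^ n) (z ^ i / (1 - z) ^ (i + 1)) := by
  rw [← hasSum_nat_add_iff' i,
    Finset.sum_eq_zero fun n hn => by
      rw [Nat.choose_eq_zero_of_lt (Finset.mem_range.1 hn)]; simp, sub_zero]
  rw [← mul_one_div]
  refine HasSum.of_forall_eq (fun n => ?_)
    ((hasSum_choose_mul_geometric_of_norm_lt_one i hz).mul_left (z ^ i))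
  rw [pow_add]
  ring

theorem choose_add_two_mul (M i : ℕ) :
    ((M + 2).choose (i + 2) : ℂ) * ((i + 1) * (i + 2)) = (M + 1) * (M + 2) * M.choose i := by
  have h1 := Nat.add_one_mul_choose_eq (M + 1) (i + 1)
  have h2 := Nat.add_one_mul_choose_eq M i
  have h1' : ((M : ℂ) + 1 + 1) * ((M + 1).choose (i + 1) : ℂ) =
      ((M + 2).choose (i + 2) : ℂ) * (i + 1 + 1) := by exact_mod_cast h1
  have h2' : ((M : ℂ) + 1) * (M.choose i : ℂ) =
      ((M + 1).choose (i + 1) : ℂ) * (i + 1) := by exact_mod_cast h2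
  linear_combination -((i : ℂ) + 1) * h1' - ((M : ℂ) + 2) * h2'

theorem exists_hasSum_halfCoeff (M : ℕ) {z : ℂ} (hz : ‖z‖ < 1) :
    ∃ g : ℂ, HasSum (fun n : ℕ => (halfCoeff M n : ℂ) * z ^ n) g ∧
      (M + 1) * (M + 2) * z ^ 2 * g =
        (1 + z) / 2 * ((1 + z) / (1 - z)) ^ (M + 1) - (1 - z) / 2 - (M + 2) * z := by
  have hz1 : 1 - z ≠ 0 := by
    rw [sub_ne_zero]; rintro rfl; simp at hz
  refine ⟨∑ i ∈ Finset.range (M + 1), (M.choose i : ℂ) * (2 ^ (i + 1) / ((i + 1) * (i + 2))) *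
    (z ^ i / (1 - z) ^ (i + 1)), ?_, ?_⟩
  · refine HasSum.of_forall_eq (fun n => ?_)
      (hasSum_sum fun i (_ : i ∈ Finset.range (M + 1)) =>
        (hasSum_choose_mul_pow i hz).mul_left
          ((M.choose i : ℂ) * (2 ^ (i + 1) / ((i + 1) * (i + 2)))))
    simp only [halfCoeff]
    push_cast
    rw [Finset.sum_mul]
    exact Finset.sum_congr rfl fun i _ => by ring
  · have hw : (1 + z) / (1 - z) = 2 * z / (1 - z) + 1 := by field_simp; ring
    have hexp : ((1 + z) / (1 - z)) ^ (M + 2) =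
        ∑ i ∈ Finset.range (M + 1), (2 * z / (1 - z)) ^ (i + 2) * ((M + 2).choose (i + 2) : ℂ)
          + (M + 2) * (2 * z / (1 - z)) + 1 := by
      rw [hw, add_pow, Finset.sum_range_succ', Finset.sum_range_succ']
      simp
      ring
    have hterm : (M + 1) * (M + 2) * z ^ 2 * ∑ i ∈ Finset.range (M + 1),
          (M.choose i : ℂ) * (2 ^ (i + 1) / ((i + 1) * (i + 2))) * (z ^ i / (1 - z) ^ (i + 1)) =
        (1 - z) / 2 * ∑ i ∈ Finset.range (M + 1),
          (2 * z / (1 - z)) ^ (i + 2) * ((M + 2).choose (i + 2) : ℂ) := by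
      rw [Finset.mul_sum, Finset.mul_sum]
      refine Finset.sum_congr rfl fun i _ => ?_
      have hi1 : (i : ℂ) + 1 ≠ 0 := by exact_mod_cast i.succ_ne_zero
      have hi2 : (i : ℂ) + 2 ≠ 0 := by exact_mod_cast (i + 1).succ_ne_zero
      have hchoose : ((M + 2).choose (i + 2) : ℂ) =
          (M + 1) * (M + 2) * M.choose i / ((i + 1) * (i + 2)) := by
        rw [eq_div_iff (mul_ne_zero hi1 hi2), choose_add_two_mul]
      rw [hchoose, div_pow, mul_pow]
      field_simp
      ring
    rw [hterm, eq_sub_of_add_eq (eq_sub_of_add_eq hexp.symm), pow_succ]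
    field_simp

theorem HasSum.even_part {a : ℕ → ℂ} {z g h : ℂ} (hg : HasSum (fun n => a n * z ^ n) g)
    (hh : HasSum (fun n => a n * (-z) ^ n) h) :
    HasSum (fun k => a (2 * k) * z ^ (2 * k)) ((g + h) / 2) := by
  have hinj : Function.Injective fun k : ℕ => 2 * k := fun a b hab => by simpa using hab
  have key := (hg.add hh).div_const 2
  rw [← hinj.hasSum_iff] at key
  · refine HasSum.of_forall_eq (fun k => ?_) key
    simp [pow_mul]
  · intro n hn
    have hodd : Odd n := by
      rw [← Nat.not_even_iff_odd]
      rintro ⟨k, rfl⟩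
      exact hn ⟨k, by simp; ring⟩
    simp [hodd.neg_pow]

/-- For `m ≥ 1` and `|z| < 1`, `D_m(z) = 2m(m+1)·z²·(1 + Σ_{k≥1} b_{2k}^m (2mz)^{2k})`, where
the coefficients satisfy `|b_{2k}^m| ≤ K := 2e²` for all `k ≥ 1` and
`|b_{2k}^m − 2/(2(k+1))!| ≤ L·e^{2k}/m` with `L := 2(e³+1)` for `1 ≤ k ≤ m`. -/
theorem Dm_expansion (m : ℕ) (hm : 1 ≤ m) :
    ∃ b : ℕ → ℝ,
      (∀ z : ℂ, ‖z‖ < 1 →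
        ∃ S : ℂ, HasSum (fun k : ℕ => ((b (k + 1) : ℝ) : ℂ) * (2 * (m : ℂ) * z) ^ (2 * (k + 1))) S ∧
          Dm m z = 2 * (m : ℂ) * ((m : ℂ) + 1) * z ^ 2 * (1 + S)) ∧
      (∀ k : ℕ, 1 ≤ k → |b k| ≤ 2 * Real.exp 2) ∧
      (∀ k : ℕ, 1 ≤ k → k ≤ m →
        |b k - 2 / (((2 * (k + 1)).factorial : ℝ))| ≤
          2 * (Real.exp 3 + 1) * Real.exp (2 * (k : ℝ)) / (m : ℝ)) := by
  obtain ⟨M, rfl⟩ : ∃ M, m = M + 1 := ⟨m - 1, by omega⟩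
  refine ⟨fun k => halfCoeff M (2 * k) / (2 * (M + 1)) ^ (2 * k), fun z hz => ?_, fun k _ => ?_,
    fun k _ _ => ?_⟩
  · obtain ⟨g, hg, hgD⟩ := exists_hasSum_halfCoeff M hz
    obtain ⟨h, hh, hhD⟩ := exists_hasSum_halfCoeff M (z := -z) (by simpa using hz)
    have hM : (M : ℂ) + 1 ≠ 0 := by exact_mod_cast M.succ_ne_zero
    refine ⟨(g + h) / 2 - 1, ?_, ?_⟩
    · have hS := (hasSum_nat_add_iff' 1).2 (hg.even_part hh)
      simp only [Finset.range_one, Finset.sum_singleton, mul_zero, halfCoeff_zero, pow_zero,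
        mul_one, ofReal_one] at hS
      refine HasSum.of_forall_eq (fun k => ?_) hS
      push_cast
      rw [mul_pow _ z]
      field_simp
    · simp only [sub_neg_eq_add, ← sub_eq_add_neg] at hhD
      unfold Dm
      push_cast
      linear_combination -hgD - hhD
  · have h1 : halfCoeff M (2 * k) / (2 * (M + 1)) ^ (2 * k) ≤ 1 :=
      div_le_one_of_le₀ (halfCoeff_le M _) (by positivity)
    rw [abs_of_nonneg (div_nonneg (halfCoeff_nonneg M _) (by positivity))]
    linarith [Real.one_le_exp (zero_le_two (α := ℝ))]
  · refine (abs_halfCoeff_div_pow_sub_le M (2 * k)).trans ?_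
    have hquad := Real.quadratic_le_exp_of_nonneg (x := 2 * (k : ℝ)) (by positivity)
    have h3 := mul_pos (Real.exp_pos 3) (Real.exp_pos (2 * (k : ℝ)))
    have hk : (0 : ℝ) ≤ k := k.cast_nonneg
    push_cast
    gcongr
    nlinarith
end

section
/- Let a > 0 and set K_0 = 2(1+a²). Then for every m ≥ 1 and every z = x + iy in the wedge V_a one has 2·sinh²(mx) ≤ |cosh(2mz) − 1| ≤ K_0·sinh²(mx). -/
open Complex

/-- The wedge `V_a = {z = x + iy ∈ ℂ : x > 0, |y| < a·x}`. -/
def wedge (a : ℝ) : Set ℂ := {z : ℂ | 0 < z.re ∧ |z.im| < a * z.re}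

theorem Complex.norm_sinh_sq (w : ℂ) :
    ‖Complex.sinh w‖ ^ 2 = Real.sinh w.re ^ 2 + Real.sin w.im ^ 2 := by
  have h : Complex.sinh w = ⟨Real.sinh w.re * Real.cos w.im, Real.cosh w.re * Real.sin w.im⟩ := by
    conv_lhs => rw [← Complex.re_add_im w, Complex.sinh_add, Complex.sinh_mul_I,
      Complex.cosh_mul_I]
    apply Complex.ext <;>
      simp [← Complex.ofReal_sinh, ← Complex.ofReal_cosh, ← Complex.ofReal_sin,
        ← Complex.ofReal_cos]
  rw [h, Complex.sq_norm, Complex.normSq_mk]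
  linear_combination Real.sinh w.re ^ 2 * Real.sin_sq_add_cos_sq w.im +
    Real.sin w.im ^ 2 * Real.cosh_sq_sub_sinh_sq w.re

theorem Complex.norm_cosh_two_mul_sub_one (w : ℂ) :
    ‖Complex.cosh (2 * w) - 1‖ = 2 * (Real.sinh w.re ^ 2 + Real.sin w.im ^ 2) := by
  have h : Complex.cosh (2 * w) - 1 = 2 * Complex.sinh w ^ 2 := by
    rw [Complex.cosh_two_mul, Complex.cosh_sq]
    ring
  rw [h, norm_mul, norm_pow, Complex.norm_sinh_sq, Complex.norm_two]

/-- For `a > 0`, `K₀ = 2(1+a²)`, `m ≥ 1` and `z = x + iy ∈ V_a`, one has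
`2 sinh²(mx) ≤ |cosh(2mz) − 1| ≤ K₀ sinh²(mx)`. -/
theorem cosh_bounds_on_wedge (a : ℝ) (ha : 0 < a) (m : ℕ) (hm : 1 ≤ m) (z : ℂ)
    (hz : z ∈ wedge a) :
    2 * Real.sinh ((m : ℝ) * z.re) ^ 2 ≤ ‖Complex.cosh (2 * (m : ℂ) * z) - 1‖ ∧
    ‖Complex.cosh (2 * (m : ℂ) * z) - 1‖ ≤ 2 * (1 + a ^ 2) * Real.sinh ((m : ℝ) * z.re) ^ 2 := by
  obtain ⟨hx, hy⟩ := hz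
  rw [mul_assoc, Complex.norm_cosh_two_mul_sub_one, ← Complex.ofReal_natCast,
    Complex.re_ofReal_mul, Complex.im_ofReal_mul]
  have hu : 0 ≤ (m : ℝ) * z.re := by positivity
  have hv : |(m : ℝ) * z.im| ≤ a * ((m : ℝ) * z.re) := by
    rw [abs_mul, Nat.abs_cast, mul_left_comm]
    gcongr
  have hsin : Real.sin (m * z.im) ^ 2 ≤ a ^ 2 * Real.sinh (m * z.re) ^ 2 := by
    rw [← mul_pow, ← sq_abs (Real.sin _)]
    gcongr
    calc |Real.sin (m * z.im)| ≤ |(m : ℝ) * z.im| := Real.abs_sin_le_abs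
      _ ≤ a * (m * z.re) := hv
      _ ≤ a * Real.sinh (m * z.re) := by
        gcongr
        exact Real.self_le_sinh_iff.2 hu
  constructor <;> nlinarith [sq_nonneg (Real.sin (m * z.im))]
end

section
/- Let α be real with either α > 1 or −(2n+1) < α < −(2n−1) for some n ∈ ℕ₀. Then the coefficients Z_N satisfy Z_N = C_α·N^{(α−3)/2}·4^N·(1 + o(1)) as N → ∞, where C_α = c_α/Γ((α−1)/2), with c_α = ∫_0^∞ t^α/(cosh(2t) − 1) dt in the case α > 1, and c_α = ∫_0^∞ (t^α/(cosh(2t) − 1) − t^α·L_n(2t)) dt in the case −(2n+1) < α < −(2n−1). -/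
open Filter MeasureTheory

/-- The numbers `A_k`, defined by the Laurent expansion
`1/(cosh(2t) − 1) = (1/(2t²))·[1 + Σ_{k≥1} A_k (2t)^{2k}]` for `0 < |t| < π`, with `A₀ = 1`. -/
def IsLaurentA (A : ℕ → ℝ) : Prop :=
  A 0 = 1 ∧
  ∀ t : ℝ, t ≠ 0 → |t| < Real.pi →
    HasSum (fun k : ℕ => A (k + 1) * (2 * t) ^ (2 * (k + 1)))
      (2 * t ^ 2 / (Real.cosh (2 * t) - 1) - 1)

/-- The Laurent polynomial `L_n(t) = (2/t²)[1 + Σ_{k=1}^n A_k t^{2k}]`. -/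
noncomputable def Lfun (A : ℕ → ℝ) (n : ℕ) (t : ℝ) : ℝ :=
  2 / t ^ 2 * (1 + ∑ k ∈ Finset.range n, A (k + 1) * t ^ (2 * (k + 1)))

/-- `Z` is the sequence of Taylor coefficients at `g = 0` of the generating function
`W_α(g) = Σ_{m≥1} m^α (X_{m+1}(g) − X_m(g))`. -/
def IsCoeffSeq (α : ℝ) (Z : ℕ → ℝ) : Prop :=
  ∀ g : ℝ, 0 < g → g < 1 / 4 →
    HasSum (fun N : ℕ => Z N * g ^ N)
      (∑' m : ℕ, ((m : ℝ) + 1) ^ α * (X (m + 2) g - X (m + 1) g))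

/-- Power series agreeing on a right neighbourhood of `0` have the same coefficients. -/
theorem powerSeries_coeff_unique {a b : ℕ → ℝ} {r : ℝ} (hr : 0 < r) {f : ℝ → ℝ}
    (ha : ∀ x, 0 < x → x < r → HasSum (fun n => a n * x ^ n) (f x))
    (hb : ∀ x, 0 < x → x < r → HasSum (fun n => b n * x ^ n) (f x)) : a = b := by
  set c : ℕ → ℝ := fun n => a n - b n with hc
  have hz : ∀ x, 0 < x → x < r → HasSum (fun n => c n * x ^ n) 0 := by
    intro x h0 h1
    have := (ha x h0 h1).sub (hb x h0 h1)
    simpa [hc, sub_mul] using this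
  let p := FormalMultilinearSeries.ofScalars ℝ c
  have hrad : ENNReal.ofReal (r / 2) ≤ p.radius := by
    apply FormalMultilinearSeries.le_radius_of_tendsto (l := 0)
    have := (hz (r / 2) (by positivity) (by linarith)).summable.tendsto_atTop_zero.norm
    simp only [norm_zero] at this
    refine this.congr fun n => ?_
    simp [p, abs_of_pos hr, Real.coe_toNNReal _ (by positivity : 0 ≤ r / 2)]
  have hp : HasFPowerSeriesOnBall p.sum p 0 p.radius :=
    p.hasFPowerSeriesOnBall (lt_of_lt_of_le (by simpa using hr) hrad)
  have hfr : ∃ᶠ x in nhdsWithin (0 : ℝ) {0}ᶜ, p.sum x = 0 := by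
    have h1 : ∀ᶠ x in nhdsWithin (0 : ℝ) (Set.Ioi 0), p.sum x = 0 := by
      filter_upwards [Ioo_mem_nhdsGT hr] with x hx
      have := (hz x hx.1 hx.2).tsum_eq
      rw [← this]
      simp [p, FormalMultilinearSeries.sum, mul_comm]
    exact h1.frequently.filter_mono (nhdsWithin_mono _ (by intro x hx; simpa using ne_of_gt hx))
  have hev := hp.analyticAt.frequently_zero_iff_eventually_zero.1 hfr
  have hp0 : p = 0 := by
    have : HasFPowerSeriesAt (0 : ℝ → ℝ) p 0 := hp.hasFPowerSeriesAt.congr hev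
    exact this.eq_zero
  funext n
  have : p n = 0 := by rw [hp0]; rfl
  have h2 : p.coeff n = 0 := by rw [FormalMultilinearSeries.coeff, this]; rfl
  rw [FormalMultilinearSeries.coeff_ofScalars] at h2
  exact sub_eq_zero.1 h2

/-- The mean of `cos ^ (2 n)` over the `M` points `π k / M`. -/
noncomputable def cosMean (n M : ℕ) : ℝ :=
  (∑ k ∈ Finset.range M, Real.cos (Real.pi * k / M) ^ (2 * n)) / M

/-- `4 ^ (n + 1) * pathFraction n M` is the coefficient of `g ^ (n + 1)` in `X (M - 1) g`. -/
noncomputable def pathFraction (n M : ℕ) : ℝ := (cosMean n M - cosMean (n + 1) M) / 2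

theorem exists_param {g : ℝ} (h0 : 0 < g) (h1 : g < 1 / 4) :
    ∃ u : ℝ, 0 < u ∧ u < 1 ∧ g = u / (1 + u) ^ 2 := by
  set s := Real.sqrt (1 - 4 * g) with hs
  have hs2 : s ^ 2 = 1 - 4 * g := Real.sq_sqrt (by linarith)
  have hs0 : 0 < s := Real.sqrt_pos.2 (by linarith)
  have hs1 : s < 1 := by nlinarith
  refine ⟨(1 - s) / (1 + s), by apply div_pos <;> linarith, by rw [div_lt_one] <;> linarith, ?_⟩
  have : 1 + (1 - s) / (1 + s) = 2 / (1 + s) := by field_simp; ring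
  rw [this]
  field_simp
  nlinarith

theorem X_eq {u : ℝ} (h0 : 0 < u) (h1 : u < 1) (m : ℕ) :
    X m (u / (1 + u) ^ 2) = u / (1 + u) * ((1 - u ^ m) / (1 - u ^ (m + 1))) := by
  induction m with
  | zero => simp [X]
  | succ m ih =>
    have a1 : 1 - u ^ (m + 1) ≠ 0 := by
      have := pow_lt_one₀ h0.le h1 (Nat.succ_ne_zero m)
      simp only [Nat.succ_eq_add_one] at this
      linarith
    have a2 : 1 - u ^ (m + 1 + 1) ≠ 0 := by
      have := pow_lt_one₀ h0.le h1 (Nat.succ_ne_zero (m+1))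
      simp only [Nat.succ_eq_add_one] at this
      linarith
    have a3 : 1 + u ≠ 0 := by linarith
    have : 1 - u / (1 + u) * ((1 - u ^ m) / (1 - u ^ (m + 1)))
        = (1 - u ^ (m + 1 + 1)) / ((1 + u) * (1 - u ^ (m + 1))) := by
      field_simp; ring
    rw [X, ih, this]
    field_simp

theorem sum_poisson {u : ℝ} (h0 : 0 < u) (h1 : u < 1) {M : ℕ} (hM : 0 < M) :
    ∑ k ∈ Finset.range M, (1 - u ^ 2) / (1 - 2 * u * Real.cos (2 * Real.pi * k / M) + u ^ 2)
      = M * ((1 + u ^ M) / (1 - u ^ M)) := by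
  have hM' : (M : ℂ) ≠ 0 := by exact_mod_cast hM.ne'
  set ω : ℂ := Complex.exp (2 * Real.pi * Complex.I / M) with hω
  have hprim : IsPrimitiveRoot ω M := Complex.isPrimitiveRoot_exp M hM.ne'
  have huM : u ^ M < 1 := pow_lt_one₀ h0.le h1 hM.ne'
  have key : ∑ k ∈ Finset.range M, (1 : ℂ) / (1 - u * ω ^ k) = M / (1 - u ^ M) := by
    have e : ∀ k ∈ Finset.range M, (1 : ℂ) / (1 - u * ω ^ k)
        = (∑ i ∈ Finset.range M, (u : ℂ) ^ i * (ω ^ i) ^ k) / (1 - u ^ M) := by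
      intro k _
      have hne : (u : ℂ) * ω ^ k ≠ 1 := by
        intro h
        have := congrArg norm h
        rw [norm_mul, norm_pow, hprim.norm'_eq_one hM.ne'] at this
        simp [abs_of_pos h0] at this
        linarith
      have hd : (1 : ℂ) - u ^ M ≠ 0 := by
        have : (1 : ℝ) - u ^ M ≠ 0 := by linarith
        exact_mod_cast this
      have hne' : (1 : ℂ) - u * ω ^ k ≠ 0 := sub_ne_zero.2 hne.symm
      rw [div_eq_div_iff hne' hd, one_mul]
      have hg := mul_neg_geom_sum ((u : ℂ) * ω ^ k) M
      rw [mul_pow, ← pow_mul, mul_comm k M, pow_mul, hprim.pow_eq_one, one_pow, mul_one] at hg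
      rw [← hg, mul_comm]
      congr 1
      refine Finset.sum_congr rfl fun i _ => ?_
      rw [mul_pow, ← pow_mul, ← pow_mul, mul_comm k i]
    rw [Finset.sum_congr rfl e, ← Finset.sum_div, Finset.sum_comm]
    congr 1
    rw [Finset.sum_eq_single_of_mem 0 (Finset.mem_range.2 hM)]
    · simp
    · intro i hi hi0
      rw [← Finset.mul_sum]
      have hne : ω ^ i ≠ 1 := hprim.pow_ne_one_of_pos_of_lt hi0 (Finset.mem_range.1 hi)
      have := mul_neg_geom_sum (ω ^ i) M
      rw [← pow_mul, mul_comm i M, pow_mul, hprim.pow_eq_one, one_pow, sub_self] at this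
      rcases mul_eq_zero.1 this with h | h
      · exact absurd (sub_eq_zero.1 h).symm hne
      · rw [h, mul_zero]
  have e2 : ∀ k ∈ Finset.range M,
      (1 - u ^ 2) / (1 - 2 * u * Real.cos (2 * Real.pi * k / M) + u ^ 2)
        = 2 * ((1 : ℂ) / (1 - u * ω ^ k)).re - 1 := by
    intro k _
    have hk : ω ^ k = Complex.exp ((2 * Real.pi * k / M : ℝ) * Complex.I) := by
      rw [hω, ← Complex.exp_nat_mul]; congr 1; push_cast; field_simp
    set φ : ℝ := 2 * Real.pi * k / M
    rw [hk, Complex.exp_mul_I, ← Complex.ofReal_cos, ← Complex.ofReal_sin]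
    rw [one_div, Complex.inv_re]
    have hcs := Real.sin_sq_add_cos_sq φ
    have hc1 := Real.cos_le_one φ
    generalize Real.cos φ = c at *
    generalize Real.sin φ = s at *
    have hn : Complex.normSq (1 - (u : ℂ) * (c + s * Complex.I)) = 1 - 2 * u * c + u ^ 2 := by
      rw [Complex.normSq_apply]
      simp
      linear_combination u ^ 2 * hcs
    rw [hn]
    have hpos : 0 < 1 - 2 * u * c + u ^ 2 := by nlinarith
    have hne := hpos.ne'
    simp only [Complex.sub_re, Complex.one_re, Complex.mul_re, Complex.ofReal_re, Complex.add_re,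
      Complex.I_re, Complex.I_im, Complex.ofReal_im, Complex.add_im, Complex.mul_im]
    rw [eq_sub_iff_add_eq, div_add_one hne, mul_div_assoc', div_left_inj' hne]
    ring
  rw [Finset.sum_congr rfl e2, Finset.sum_sub_distrib, ← Finset.mul_sum, ← Complex.re_sum, key]
  have : ((M : ℂ) / (1 - u ^ M)).re = M / (1 - u ^ M) := by
    rw [← Complex.ofReal_natCast, ← Complex.ofReal_pow, ← Complex.ofReal_one, ← Complex.ofReal_sub,
      ← Complex.ofReal_div, Complex.ofReal_re]
  rw [this]
  simp
  have : 1 - u ^ M ≠ 0 := by linarith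
  field_simp
  ring

theorem hasSum_X {g : ℝ} (h0 : 0 < g) (h1 : g < 1 / 4) (m : ℕ) :
    HasSum (fun n : ℕ => 4 ^ (n + 1) * pathFraction n (m + 1) * g ^ (n + 1)) (X m g) := by
  obtain ⟨u, hu0, hu1, rfl⟩ := exists_param h0 h1
  set g := u / (1 + u) ^ 2 with hg
  set M := m + 1 with hM
  have hMp : (0 : ℝ) < M := by positivity
  have hc : ∀ k : ℕ, 4 * g * Real.cos (Real.pi * k / M) ^ 2 < 1 := by
    intro k
    nlinarith [Real.cos_sq_le_one (Real.pi * k / M)]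
  have hs : HasSum (fun n : ℕ => ∑ k ∈ Finset.range M,
      (2 * g * (1 - Real.cos (Real.pi * k / M) ^ 2) / M) * (4 * g * Real.cos (Real.pi * k / M) ^ 2) ^ n)
      (∑ k ∈ Finset.range M, (2 * g * (1 - Real.cos (Real.pi * k / M) ^ 2) / M) *
        (1 - 4 * g * Real.cos (Real.pi * k / M) ^ 2)⁻¹) := by
    refine hasSum_sum fun k _ => HasSum.mul_left _ (hasSum_geometric_of_lt_one (by positivity) (hc k))
  have hval : (∑ k ∈ Finset.range M, (2 * g * (1 - Real.cos (Real.pi * k / M) ^ 2) / M) *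
        (1 - 4 * g * Real.cos (Real.pi * k / M) ^ 2)⁻¹) = X m g := by
    have hp := sum_poisson hu0 hu1 (M := M) (Nat.succ_pos m)
    have hM1 : u ^ M < 1 := pow_lt_one₀ hu0.le hu1 (Nat.succ_ne_zero m)
    have e : ∀ k ∈ Finset.range M, (2 * g * (1 - Real.cos (Real.pi * k / M) ^ 2) / M) *
        (1 - 4 * g * Real.cos (Real.pi * k / M) ^ 2)⁻¹
        = 1 / (2 * M) - (1 - u) / (2 * M * (1 + u)) * ((1 - u ^ 2) / (1 - 2 * u * Real.cos (2 * Real.pi * k / M) + u ^ 2)) := by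
      intro k _
      have hcos : Real.cos (2 * Real.pi * k / M) = 2 * Real.cos (Real.pi * k / M) ^ 2 - 1 := by
        rw [← Real.cos_two_mul]; congr 1; ring
      rw [hcos]
      have hk := hc k
      set c := Real.cos (Real.pi * k / M) ^ 2
      have hd : 1 - 2 * u * (2 * c - 1) + u ^ 2 = (1 + u) ^ 2 * (1 - 4 * g * c) := by
        rw [hg]; field_simp; ring
      have hne : 1 - 4 * g * c ≠ 0 := by linarith
      rw [hd]
      have hu' : u = g * (1 + u) ^ 2 := by rw [hg]; field_simp
      have h1u : (1 + u) ≠ 0 := by linarith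
      clear_value c g
      have hz : (1 - u) / (2 * M * (1 + u)) * ((1 - u ^ 2) / ((1 + u) ^ 2 * (1 - 4 * g * c)))
          = (1 - 4 * g) / (2 * M * (1 - 4 * g * c)) := by
        have : (1 - 4 * g) * (1 + u) ^ 2 = (1 - u) ^ 2 := by linear_combination 4 * hu'
        rw [div_mul_div_comm, div_eq_div_iff (by positivity) (by positivity)]
        linear_combination (-(2 * M * (1 - 4 * g * c)) * (1 + u)) * this
      rw [hz]
      generalize hd' : 1 - 4 * g * c = d at hne ⊢
      field_simp
      linear_combination hd'
    rw [Finset.sum_congr rfl e, Finset.sum_sub_distrib, ← Finset.mul_sum, hp, hg, X_eq hu0 hu1]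
    have h3 : 1 - u ^ M ≠ 0 := by linarith
    have h1u : (1 + u) ≠ 0 := by linarith
    rw [Finset.sum_const, Finset.card_range, nsmul_eq_mul]
    rw [hM] at h3 ⊢
    field_simp
    ring
  rw [hval] at hs
  convert hs using 2 with n
  rw [pathFraction, cosMean, cosMean, ← sub_div, ← Finset.sum_sub_distrib, div_div, mul_div_assoc',
    div_mul_eq_mul_div, Finset.mul_sum, Finset.sum_mul, Finset.sum_div]
  refine Finset.sum_congr rfl fun k _ => ?_
  field_simp
  ring

theorem sum_root_pow {M : ℕ} (hM : 0 < M) (j : ℤ) :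
    ∑ k ∈ Finset.range M, Complex.exp (2 * (Real.pi * k / M : ℝ) * j * Complex.I)
      = if (M : ℤ) ∣ j then (M : ℂ) else 0 := by
  set ω : ℂ := Complex.exp (2 * Real.pi * Complex.I / M) with hω
  have hprim : IsPrimitiveRoot ω M := Complex.isPrimitiveRoot_exp M hM.ne'
  have e : ∀ k ∈ Finset.range M, Complex.exp (2 * (Real.pi * k / M : ℝ) * j * Complex.I)
      = (ω ^ j) ^ k := by
    intro k _
    rw [hω, ← Complex.exp_int_mul, ← Complex.exp_nat_mul]
    congr 1
    push_cast
    ring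
  rw [Finset.sum_congr rfl e]
  split_ifs with h
  · rw [(hprim.zpow_eq_one_iff_dvd j).2 h]; simp
  · have hne : ω ^ j ≠ 1 := fun h' => h ((hprim.zpow_eq_one_iff_dvd j).1 h')
    have := mul_neg_geom_sum (ω ^ j) M
    rw [← zpow_natCast, ← zpow_mul, mul_comm j, zpow_mul, zpow_natCast, hprim.pow_eq_one, one_zpow,
      sub_self] at this
    rcases mul_eq_zero.1 this with h | h
    · exact absurd (sub_eq_zero.1 h).symm hne
    · exact h

theorem cos_pow_two_mul (n : ℕ) (x : ℝ) :
    ((Real.cos x ^ (2 * n) : ℝ) : ℂ) = (∑ l ∈ Finset.range (2 * n + 1),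
      ((2 * n).choose l : ℂ) * Complex.exp (2 * x * ((l : ℤ) - (n : ℤ) : ℤ) * Complex.I)) / 4 ^ n := by
  have h : (4 : ℂ) ^ n = 2 ^ (2 * n) := by rw [pow_mul]; norm_num
  push_cast
  rw [Complex.cos, div_pow, h, add_pow]
  congr 1
  refine Finset.sum_congr rfl fun l hl => ?_
  have hl : l ≤ 2 * n := by simpa [Nat.lt_succ_iff] using hl
  rw [← Complex.exp_nat_mul, ← Complex.exp_nat_mul, ← Complex.exp_add, mul_comm]
  congr 2
  rw [Nat.cast_sub hl]
  push_cast
  ring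

/-- Aliasing: averaging over the grid keeps the frequencies divisible by `M`. -/
theorem cosMean_eq (n : ℕ) {M : ℕ} (hM : 0 < M) :
    cosMean n M = (∑ l ∈ Finset.range (2 * n + 1),
      if (M : ℤ) ∣ (l : ℤ) - (n : ℤ) then ((2 * n).choose l : ℝ) else 0) / 4 ^ n := by
  have hM' : (M : ℂ) ≠ 0 := by exact_mod_cast hM.ne'
  have : ((cosMean n M : ℝ) : ℂ) = ((∑ l ∈ Finset.range (2 * n + 1),
      if (M : ℤ) ∣ (l : ℤ) - (n : ℤ) then ((2 * n).choose l : ℝ) else 0) / 4 ^ n : ℝ) := by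
    rw [cosMean, Complex.ofReal_div, Complex.ofReal_sum]
    simp_rw [cos_pow_two_mul]
    rw [← Finset.sum_div, Finset.sum_comm]
    simp_rw [← Finset.mul_sum, sum_root_pow hM]
    push_cast
    rw [div_right_comm, Finset.sum_div]
    congr 1
    refine Finset.sum_congr rfl fun l _ => ?_
    split_ifs <;> simp [hM']
  exact_mod_cast this

theorem choose_diff (n l : ℕ) (hl : l ≤ 2 * n + 1) :
    4 * ((2 * n).choose l : ℝ) - ((2 * n + 2).choose (l + 1) : ℝ)
      = ((2 * n + 2).choose (l + 1) : ℝ) * (((n : ℝ) + 1) - 2 * ((l : ℝ) - n) ^ 2) /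
        (((n : ℝ) + 1) * (2 * n + 1)) := by
  have h1 : ((2 * n + 2).choose (l + 1) : ℝ) * (l + 1) = (2 * n + 2) * ((2 * n + 1).choose l) := by
    exact_mod_cast (Nat.add_one_mul_choose_eq (2 * n + 1) l).symm
  have h2 : ((2 * n + 1).choose l : ℝ) * ((2 * n + 1 : ℝ) - l) = (2 * n + 1) * ((2 * n).choose l) := by
    have := Nat.choose_mul_succ_eq (2 * n) l
    have h3 : ((2 * n + 1 - l : ℕ) : ℝ) = (2 * n + 1 : ℝ) - l := by
      rw [Nat.cast_sub hl]; push_cast; ring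
    rw [← h3]
    have h4 : ((2 * n).choose l : ℝ) * (2 * n + 1) = ((2 * n + 1).choose l) * ((2 * n + 1 - l : ℕ) : ℝ) := by
      exact_mod_cast this
    linarith
  have hn : ((n : ℝ) + 1) * (2 * n + 1) ≠ 0 := by positivity
  rw [eq_div_iff hn]
  linear_combination (-4 * ((n : ℝ) + 1)) * h2 - (2 * n + 1 - l : ℝ) * 2 * h1

theorem pathFraction_eq (n : ℕ) {M : ℕ} (hM : 0 < M) :
    pathFraction n M = (∑ l ∈ Finset.range (2 * n + 3),
      if (M : ℤ) ∣ (l : ℤ) - ((n : ℤ) + 1) then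
        ((2 * n + 2).choose l : ℝ) * (((n : ℝ) + 1) - 2 * ((l : ℝ) - (n + 1)) ^ 2) /
          (((n : ℝ) + 1) * (2 * n + 1)) else 0) / (2 * 4 ^ (n + 1)) := by
  have hn : ((n : ℝ) + 1) * (2 * n + 1) ≠ 0 := by positivity
  have h1 : cosMean n M = (∑ l ∈ Finset.range (2 * n + 2),
      if (M : ℤ) ∣ ((l + 1 : ℕ) : ℤ) - ((n : ℤ) + 1) then 4 * ((2 * n).choose l : ℝ) else 0) / 4 ^ (n + 1) := by
    rw [cosMean_eq n hM, Finset.sum_range_succ _ (2 * n + 1), Nat.choose_succ_self, pow_succ',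
      ← div_div]
    congr 1
    simp only [Nat.cast_zero, mul_zero, ite_self, add_zero]
    rw [Finset.sum_div]
    refine Finset.sum_congr rfl fun l _ => ?_
    have : ((l + 1 : ℕ) : ℤ) - ((n : ℤ) + 1) = l - n := by push_cast; ring
    rw [this]
    split_ifs <;> simp
  rw [pathFraction, h1, cosMean_eq (n + 1) hM, ← sub_div, div_div, mul_comm _ (2 : ℝ)]
  congr 1
  rw [show 2 * (n + 1) + 1 = 2 * n + 2 + 1 from rfl, Finset.sum_range_succ' _ (2 * n + 2),
    Finset.sum_range_succ' _ (2 * n + 2), ← sub_sub, ← Finset.sum_sub_distrib, sub_eq_add_neg]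
  congr 1
  · refine Finset.sum_congr rfl fun l hl => ?_
    have hl : l ≤ 2 * n + 1 := by simpa [Nat.lt_succ_iff] using hl
    have e : ((l + 1 : ℕ) : ℤ) - ((n + 1 : ℕ) : ℤ) = ((l + 1 : ℕ) : ℤ) - ((n : ℤ) + 1) := by push_cast; ring
    rw [e]
    split_ifs
    · have := choose_diff n l hl
      rw [show 2 * (n + 1) = 2 * n + 2 by ring, this]
      push_cast
      ring
    · simp
  · have e : ((0 : ℕ) : ℤ) - ((n + 1 : ℕ) : ℤ) = ((0 : ℕ) : ℤ) - ((n : ℤ) + 1) := by push_cast; ring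
    rw [e]
    split_ifs
    · simp only [Nat.choose_zero_right]
      rw [eq_div_iff hn]
      push_cast
      ring
    · simp

/-- The stable value of `pathFraction n M` for `M > n + 1`. -/
noncomputable def stableFraction (n : ℕ) : ℝ :=
  ((2 * n + 2).choose (n + 1) : ℝ) / ((2 * n + 1) * (2 * 4 ^ (n + 1)))

/-- The difference to the stable value only involves non-zero multiples of `M`. -/
theorem pathFraction_sub_stable (n : ℕ) {M : ℕ} (hM : 0 < M) :
    pathFraction n M - stableFraction n
      = (∑ l ∈ ((Finset.range (2 * n + 3)).erase (n + 1)).filter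
          (fun l : ℕ => (M : ℤ) ∣ (l : ℤ) - ((n : ℤ) + 1)),
        ((2 * n + 2).choose l : ℝ) * (((n : ℝ) + 1) - 2 * ((l : ℝ) - (n + 1)) ^ 2) /
          (((n : ℝ) + 1) * (2 * n + 1))) / (2 * 4 ^ (n + 1)) := by
  have hmem : n + 1 ∈ Finset.range (2 * n + 3) := by simp; omega
  rw [pathFraction_eq n hM, ← Finset.add_sum_erase _ _ hmem, stableFraction,
    ← div_div _ (2 * (n : ℝ) + 1), ← sub_div, Finset.sum_filter]
  congr 1
  rw [sub_eq_iff_eq_add', add_left_inj]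
  have : (0 : ℝ) < n + 1 := by positivity
  simp
  field_simp

theorem pathFraction_stable {n M : ℕ} (hM : n + 1 < M) : pathFraction n M = stableFraction n := by
  have h := pathFraction_sub_stable n (M := M) (by omega)
  rw [Finset.filter_eq_empty_iff.2] at h
  · simpa [sub_eq_zero] using h
  · intro l hl hd
    simp only [Finset.mem_erase, Finset.mem_range] at hl
    have := Int.eq_zero_of_abs_lt_dvd hd (by rw [abs_lt]; constructor <;> omega)
    omega

theorem centralBinom_antitone :
    Antitone fun N : ℕ => ((2 * N).choose N : ℝ) ^ 2 * (2 * N + 1) / 16 ^ N := by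
  refine antitone_nat_of_succ_le fun N => ?_
  have h : ((N : ℝ) + 1) * ((2 * (N + 1)).choose (N + 1)) = 2 * (2 * N + 1) * ((2 * N).choose N) := by
    have := Nat.succ_mul_centralBinom_succ N
    simp only [Nat.centralBinom] at this
    exact_mod_cast this
  rw [pow_succ (16 : ℝ), ← div_div, div_right_comm]
  gcongr
  have hp : (0 : ℝ) < (N + 1) ^ 2 := by positivity
  rw [div_le_iff₀ (by norm_num), ← mul_le_mul_iff_right₀ hp]
  have e : ((N : ℝ) + 1) ^ 2 * (((2 * (N + 1)).choose (N + 1) : ℝ) ^ 2 * (2 * ((N + 1 : ℕ) : ℝ) + 1))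
      = 4 * (2 * N + 1) * (2 * N + 3) * (((2 * N).choose N : ℝ) ^ 2 * (2 * N + 1)) := by
    push_cast
    rw [← mul_assoc, ← mul_pow, h]; ring
  rw [e]
  have : 0 ≤ ((2 * N).choose N : ℝ) ^ 2 * (2 * N + 1) := by positivity
  nlinarith

theorem centralBinom_bound (N : ℕ) :
    ((2 * N).choose N : ℝ) * Real.sqrt (2 * N + 1) ≤ 4 ^ N := by
  have h := centralBinom_antitone (Nat.zero_le N)
  simp only [mul_zero, Nat.choose_self, Nat.cast_one, one_pow, Nat.cast_zero, zero_add, mul_one,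
    pow_zero, div_one] at h
  rw [div_le_one (by positivity)] at h
  refine le_of_sq_le_sq ?_ (by positivity)
  rw [mul_pow, Real.sq_sqrt (by positivity), ← pow_mul, mul_comm N, pow_mul]
  norm_num
  exact h

theorem tendsto_centralBinom : ∃ L : ℝ,
    Tendsto (fun N : ℕ => ((2 * N).choose N : ℝ) ^ 2 * (2 * N + 1) / 16 ^ N) atTop (nhds L) :=
  ⟨_, tendsto_atTop_ciInf centralBinom_antitone ⟨0, by rintro _ ⟨N, rfl⟩; positivity⟩⟩

/-- The scaled stable values converge. -/
theorem tendsto_stableFraction : ∃ L : ℝ,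
    Tendsto (fun n : ℕ => ((n : ℝ) + 1) ^ (3 / 2 : ℝ) * stableFraction n) atTop (nhds L) := by
  obtain ⟨L, hL⟩ := tendsto_centralBinom
  have h1 := ((tendsto_add_atTop_iff_nat 1).2 hL).sqrt
  have h2 : Tendsto (fun n : ℕ => 1 / (2 * (2 * (n : ℝ) + 1)) * ((n : ℝ) + 1)) atTop (nhds (1 / 4)) := by
    have h3 : Tendsto (fun n : ℕ => 1 / 4 + 1 / 8 * (1 / ((n : ℝ) + 1 / 2))) atTop (nhds (1 / 4 + 1 / 8 * 0)) := by
      refine Tendsto.add tendsto_const_nhds (Tendsto.mul tendsto_const_nhds ?_)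
      refine tendsto_const_nhds.div_atTop ?_
      exact tendsto_atTop_add_const_right _ _ tendsto_natCast_atTop_atTop
    rw [mul_zero, add_zero] at h3
    refine h3.congr fun n => ?_
    field_simp
    ring
  have h4 : Tendsto (fun n : ℕ => (((n : ℝ) + 1) / (2 * n + 3))) atTop (nhds (1 / 2)) := by
    have h3 : Tendsto (fun n : ℕ => 1 / 2 - 1 / 4 * (1 / ((n : ℝ) + 3 / 2))) atTop (nhds (1 / 2 - 1 / 4 * 0)) := by
      refine Tendsto.sub tendsto_const_nhds (Tendsto.mul tendsto_const_nhds ?_)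
      refine tendsto_const_nhds.div_atTop ?_
      exact tendsto_atTop_add_const_right _ _ tendsto_natCast_atTop_atTop
    rw [mul_zero, sub_zero] at h3
    refine h3.congr fun n => ?_
    field_simp
    ring
  refine ⟨_, ((h1.mul h2).mul h4.sqrt).congr fun n => ?_⟩
  have e16 : (16 : ℝ) ^ (n + 1) = (4 ^ (n + 1)) ^ 2 := by rw [← pow_mul, mul_comm, pow_mul]; norm_num
  have hr : ((n : ℝ) + 1) ^ (3 / 2 : ℝ) = (n + 1) * Real.sqrt (n + 1) := by
    rw [show (3 / 2 : ℝ) = 1 + 1 / 2 by norm_num, Real.rpow_add (by positivity), Real.rpow_one,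
      Real.sqrt_eq_rpow]
  rw [hr, e16, stableFraction, Real.sqrt_div (by positivity), Real.sqrt_sq (by positivity),
    Real.sqrt_div (by positivity), Real.sqrt_mul (by positivity), Real.sqrt_sq (by positivity)]
  have e3 : 2 * (((n + 1 : ℕ) : ℝ)) + 1 = 2 * n + 3 := by push_cast; ring
  rw [e3, show 2 * (n + 1) = 2 * n + 2 by ring]
  have : Real.sqrt (2 * n + 3) ≠ 0 := by positivity
  field_simp

theorem choose_add_le_gaussian (N j : ℕ) :
    ((2 * N).choose (N + j) : ℝ) ≤ (2 * N).choose N * Real.exp (-(j : ℝ) ^ 2 / (2 * N)) := by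
  induction j with
  | zero => simp
  | succ j ih =>
    rcases Nat.lt_or_ge j N with hj | hj
    · have hN : (0 : ℝ) < N := by exact_mod_cast (Nat.zero_le j).trans_lt hj
      have hjN : (j : ℝ) + 1 ≤ N := by exact_mod_cast hj
      have h : ((2 * N).choose (N + (j + 1)) : ℝ) * (N + j + 1) = (2 * N).choose (N + j) * (N - j) := by
        have := Nat.choose_succ_right_eq (2 * N) (N + j)
        have e : 2 * N - (N + j) = N - j := by omega
        rw [e] at this
        have h2 : ((N - j : ℕ) : ℝ) = N - j := by rw [Nat.cast_sub hj.le]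
        rw [← h2]
        exact_mod_cast this
      have h1 : ((N : ℝ) - j) / (N + j + 1) ≤ Real.exp (-(2 * j + 1) / (2 * N)) := by
        refine le_trans ?_ (Real.add_one_le_exp _)
        rw [div_le_iff₀ (by positivity), neg_div, ← sub_nonneg]
        have : (N + j + 1 : ℝ) / (2 * N) ≤ 1 := by rw [div_le_one (by positivity)]; linarith
        have h3 : (2 * (j : ℝ) + 1) * ((N + j + 1 : ℝ) / (2 * N)) ≤ 2 * j + 1 :=
          mul_le_of_le_one_right (by positivity) this
        have : (-((2 * (j : ℝ) + 1) / (2 * N)) + 1) * (N + j + 1)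
            = N + j + 1 - (2 * (j : ℝ) + 1) * ((N + j + 1 : ℝ) / (2 * N)) := by ring
        rw [this]; linarith
      have h4 : ((2 * N).choose (N + (j + 1)) : ℝ) = (2 * N).choose (N + j) * (((N : ℝ) - j) / (N + j + 1)) := by
        field_simp; linarith
      rw [h4]
      calc _ ≤ ((2 * N).choose N * Real.exp (-(j : ℝ) ^ 2 / (2 * N))) * Real.exp (-(2 * j + 1) / (2 * N)) := by
            gcongr
            exact div_nonneg (by linarith) (by positivity)
        _ = _ := by
            rw [mul_assoc, ← Real.exp_add]
            congr 2
            push_cast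
            field_simp
            ring
    · rw [Nat.choose_eq_zero_of_lt (by omega), Nat.cast_zero]
      positivity

theorem choose_le_gaussian {N l : ℕ} (hl : l ≤ 2 * N) :
    ((2 * N).choose l : ℝ) ≤ (2 * N).choose N * Real.exp (-((l : ℝ) - N) ^ 2 / (2 * N)) := by
  rcases le_total N l with h | h
  · obtain ⟨j, rfl⟩ := Nat.exists_eq_add_of_le h
    simpa using choose_add_le_gaussian N j
  · obtain ⟨j, rfl⟩ := Nat.exists_eq_add_of_le h
    have := choose_add_le_gaussian (l + j) j
    rw [← Nat.choose_symm hl, show 2 * (l + j) - l = l + j + j by omega]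
    convert this using 5
    push_cast; ring

theorem exp_half_bound (p : ℕ) : ∃ K : ℝ, 0 ≤ K ∧ ∀ x : ℝ, 0 < x →
    Real.exp (-(x / 2)) * (1 + 2 * x) ≤ K * (1 / x) ^ p := by
  refine ⟨2 ^ p * p.factorial + 4 * (2 ^ p * (p + 1).factorial), by positivity, fun x hx => ?_⟩
  have h : ∀ q : ℕ, x ^ q * Real.exp (-(x / 2)) ≤ 2 ^ q * q.factorial := by
    intro q
    have := Real.pow_div_factorial_le_exp (x / 2) (by positivity) q
    rw [div_le_iff₀ (by positivity), div_pow, div_le_iff₀ (by positivity)] at this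
    rw [Real.exp_neg, ← div_eq_mul_inv, div_le_iff₀ (Real.exp_pos _)]
    linarith
  have h1 := h p
  have h2 := h (p + 1)
  rw [one_div, inv_pow, ← div_eq_mul_inv, le_div_iff₀ (by positivity)]
  rw [pow_succ, pow_succ] at h2
  nlinarith

/-- Polynomial decay of the difference to the stable value, on the scale `M ≍ √n`. -/
theorem pathFraction_tail {p : ℕ} (hp : 1 ≤ p) : ∃ K : ℝ, 0 ≤ K ∧ ∀ n M : ℕ, 0 < M →
    ((n : ℝ) + 1) ^ (3 / 2 : ℝ) * |pathFraction n M - stableFraction n|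
      ≤ K * (((n : ℝ) + 1) / M ^ 2) ^ p := by
  obtain ⟨K, hK0, hK⟩ := exp_half_bound p
  have hsum : Summable fun i : ℤ => 1 / (i : ℝ) ^ 2 := Real.summable_one_div_int_pow.2 (by norm_num)
  refine ⟨K * ∑' i : ℤ, 1 / (i : ℝ) ^ 2, mul_nonneg hK0 (tsum_nonneg fun i => by positivity),
    fun n M hM => ?_⟩
  have hMr : (0 : ℝ) < M := by exact_mod_cast hM
  set N : ℝ := (n : ℝ) + 1 with hN
  have hN0 : 0 < N := by positivity
  rw [pathFraction_sub_stable n hM]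
  set S := ((Finset.range (2 * n + 3)).erase (n + 1)).filter
          (fun l : ℕ => (M : ℤ) ∣ (l : ℤ) - ((n : ℤ) + 1)) with hS
  have hr : N ^ (3 / 2 : ℝ) = N * Real.sqrt N := by
    rw [show (3 / 2 : ℝ) = 1 + 1 / 2 by norm_num, Real.rpow_add hN0, Real.rpow_one, Real.sqrt_eq_rpow]
  have hterm : ∀ l ∈ S, N ^ (3 / 2 : ℝ) * (|((2 * n + 2).choose l : ℝ) * (N - 2 * ((l : ℝ) - N) ^ 2) /
          (N * (2 * n + 1))| / (2 * 4 ^ (n + 1)))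
      ≤ (K * (N / M ^ 2) ^ p) * (1 / (((((l : ℤ) - ((n : ℤ) + 1)) / (M : ℤ) : ℤ)) : ℝ) ^ 2) := by
    intro l hl
    simp only [hS, Finset.mem_filter, Finset.mem_erase, Finset.mem_range] at hl
    obtain ⟨⟨hl1, hl2⟩, hd⟩ := hl
    obtain ⟨i, hi⟩ := hd
    have hi0 : i ≠ 0 := by rintro rfl; omega
    rw [hi, Int.mul_ediv_cancel_left _ (by omega)]
    have hi' : (l : ℝ) - N = M * i := by rw [hN]; exact_mod_cast hi
    have hi1 : (1 : ℝ) ≤ (i : ℝ) ^ 2 := by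
      have : 1 ≤ i ^ 2 := by have := sq_pos_of_ne_zero hi0 ; omega
      exact_mod_cast this
    set x : ℝ := ((l : ℝ) - N) ^ 2 / N with hx
    have hx0 : 0 < x := by rw [hx, hi']; positivity
    have hg := choose_le_gaussian (N := n + 1) (l := l) (by omega)
    have hc := centralBinom_bound (n + 1)
    have he : -((l : ℝ) - ((n + 1 : ℕ) : ℝ)) ^ 2 / (2 * ((n + 1 : ℕ) : ℝ)) = -(x / 2) := by
      rw [hx, hN]; push_cast; field_simp
    rw [he, show 2 * (n + 1) = 2 * n + 2 by ring] at hg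
    rw [show 2 * (n + 1) = 2 * n + 2 by ring] at hc
    have hs : Real.sqrt N ≤ Real.sqrt (2 * ((n + 1 : ℕ) : ℝ) + 1) := by
      apply Real.sqrt_le_sqrt; push_cast; rw [hN]; linarith
    have hc' : ((2 * n + 2).choose (n + 1) : ℝ) * Real.sqrt N ≤ 4 ^ (n + 1) :=
      le_trans (by gcongr) hc
    have habs : |N - 2 * ((l : ℝ) - N) ^ 2| ≤ N * (1 + 2 * x) := by
      have : N * (1 + 2 * x) = N + 2 * ((l : ℝ) - N) ^ 2 := by rw [hx]; field_simp
      rw [this, abs_le]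
      constructor <;> nlinarith [sq_nonneg ((l : ℝ) - N)]
    have h2n : N ≤ 2 * n + 1 := by rw [hN]; have : (0 : ℝ) ≤ n := by positivity
                                   linarith
    rw [abs_div, abs_mul, Nat.abs_cast, abs_of_pos (by positivity : 0 < N * (2 * (n : ℝ) + 1)), hr]
    have hxi : (1 / x) ^ p ≤ (N / M ^ 2) ^ p * (1 / (i : ℝ) ^ 2) := by
      have : 1 / x = N / M ^ 2 * (1 / (i : ℝ) ^ 2) := by rw [hx, hi']; field_simp
      rw [this, mul_pow]
      gcongr
      refine pow_le_of_le_one (by positivity) ?_ (by omega)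
      rw [div_le_one (by positivity)]; exact hi1
    calc N * Real.sqrt N * (((2 * n + 2).choose l : ℝ) * |N - 2 * ((l : ℝ) - N) ^ 2| /
          (N * (2 * n + 1)) / (2 * 4 ^ (n + 1)))
        ≤ N * Real.sqrt N * ((((2 * n + 2).choose (n + 1) : ℝ) * Real.exp (-(x / 2))) * (N * (1 + 2 * x)) /
          (N * N) / (1 * 4 ^ (n + 1))) := by gcongr; norm_num
      _ = (((2 * n + 2).choose (n + 1) : ℝ) * Real.sqrt N / 4 ^ (n + 1)) *
            (Real.exp (-(x / 2)) * (1 + 2 * x)) := by field_simp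
      _ ≤ 1 * (K * (1 / x) ^ p) := by
          refine mul_le_mul ?_ (hK x hx0) (by positivity) zero_le_one
          rw [div_le_one (by positivity)]; exact hc'
      _ ≤ K * ((N / M ^ 2) ^ p * (1 / (i : ℝ) ^ 2)) := by rw [one_mul]; gcongr
      _ = _ := by ring
  have hinj : Set.InjOn (fun l : ℕ => (((l : ℤ) - ((n : ℤ) + 1)) / (M : ℤ))) S := by
    intro a ha b hb hab
    simp only [hS, Finset.coe_filter, Set.mem_ofPred_eq] at ha hb hab
    obtain ⟨i, hi⟩ := ha.2
    obtain ⟨i', hi'⟩ := hb.2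
    rw [hi, hi', Int.mul_ediv_cancel_left _ (by omega), Int.mul_ediv_cancel_left _ (by omega)] at hab
    rw [hab] at hi
    omega
  calc _ ≤ N ^ (3 / 2 : ℝ) * ((∑ l ∈ S, |((2 * n + 2).choose l : ℝ) * (N - 2 * ((l : ℝ) - N) ^ 2) /
          (N * (2 * n + 1))|) / (2 * 4 ^ (n + 1))) := by
        rw [abs_div, abs_of_pos (by positivity : (0 : ℝ) < 2 * 4 ^ (n + 1))]
        gcongr
        exact Finset.abs_sum_le_sum_abs _ _
    _ = ∑ l ∈ S, N ^ (3 / 2 : ℝ) * (|((2 * n + 2).choose l : ℝ) * (N - 2 * ((l : ℝ) - N) ^ 2) /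
          (N * (2 * n + 1))| / (2 * 4 ^ (n + 1))) := by rw [Finset.sum_div, Finset.mul_sum]
    _ ≤ ∑ l ∈ S, (K * (N / M ^ 2) ^ p) * (1 / (((((l : ℤ) - ((n : ℤ) + 1)) / (M : ℤ) : ℤ)) : ℝ) ^ 2) :=
        Finset.sum_le_sum hterm
    _ = (K * (N / M ^ 2) ^ p) * ∑ i ∈ S.image (fun l : ℕ => (((l : ℤ) - ((n : ℤ) + 1)) / (M : ℤ))),
          1 / (i : ℝ) ^ 2 := by
        rw [← Finset.mul_sum, Finset.sum_image hinj]
    _ ≤ (K * (N / M ^ 2) ^ p) * ∑' i : ℤ, 1 / (i : ℝ) ^ 2 := by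
        gcongr
        exact hsum.sum_le_tsum _ fun i _ => by positivity
    _ = _ := by ring

theorem sum_fold (f : ℕ → ℝ) (M : ℕ) (h0 : f 0 = 0) (hf : ∀ k ≤ M, f (M - k) = f k) :
    ∑ k ∈ Finset.range M, f k = ∑ k ∈ Finset.range M,
      ((if 2 * k ≤ M then 1 else 0) + (if 2 * k < M then 1 else 0)) * f k := by
  have key : ∑ k ∈ Finset.range M, (if 2 * k ≤ M then 0 else f k)
      = ∑ k ∈ Finset.range M, (if 2 * k < M then f k else 0) := by
    rcases M with _ | m
    · simp
    · rw [Finset.sum_range_succ', Finset.sum_range_succ' (fun k => if 2 * k < m + 1 then f k else 0),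
        ← Finset.sum_range_reflect]
      simp only [h0, ite_self, add_zero]
      refine Finset.sum_congr rfl fun k hk => ?_
      have hk' := Finset.mem_range.1 hk
      have e : m - 1 - k + 1 = m + 1 - (k + 1) := by omega
      rw [e, hf (k + 1) (by omega)]
      split_ifs <;> first | rfl | (exfalso; omega)
  have : ∀ k ∈ Finset.range M, f k = (if 2 * k ≤ M then f k else 0) + (if 2 * k ≤ M then 0 else f k) := by
    intro k _; split_ifs <;> simp
  rw [Finset.sum_congr rfl this, Finset.sum_add_distrib, key, ← Finset.sum_add_distrib]
  refine Finset.sum_congr rfl fun k _ => ?_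
  split_ifs <;> ring

/-- The folded spectral terms. -/
noncomputable def spectralTerm (n M k : ℕ) : ℝ :=
  ((if 2 * k ≤ M then 1 else 0) + (if 2 * k < M then 1 else 0)) *
    (Real.cos (Real.pi * k / M) ^ (2 * n) * Real.sin (Real.pi * k / M) ^ 2)

theorem pathFraction_eq_sum_sin (n M : ℕ) : pathFraction n M = (∑ k ∈ Finset.range M,
    Real.cos (Real.pi * k / M) ^ (2 * n) * Real.sin (Real.pi * k / M) ^ 2) / (2 * M) := by
  rw [pathFraction, cosMean, cosMean, ← sub_div, ← Finset.sum_sub_distrib, div_div, mul_comm (2 : ℝ)]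
  congr 1
  refine Finset.sum_congr rfl fun k _ => ?_
  rw [Real.sin_sq]; ring

theorem pathFraction_eq_tsum (n : ℕ) {M : ℕ} (hM : 0 < M) :
    pathFraction n M = (∑' k, spectralTerm n M k) / (2 * M) := by
  have hM' : (M : ℝ) ≠ 0 := by exact_mod_cast hM.ne'
  rw [pathFraction_eq_sum_sin, sum_fold _ M (by simp), tsum_eq_sum (s := Finset.range M)]
  · rfl
  · intro k hk
    have hk : M ≤ k := by simpa using hk
    rw [spectralTerm, if_neg (by omega), if_neg (by omega)]
    simp
  · intro k hk
    have e : Real.pi * ((M - k : ℕ) : ℝ) / M = Real.pi - Real.pi * k / M := by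
      rw [Nat.cast_sub hk]; field_simp
    rw [e, Real.cos_pi_sub, Real.sin_pi_sub, pow_mul, neg_sq, ← pow_mul]

theorem spectralTerm_nonneg (n M k : ℕ) : 0 ≤ spectralTerm n M k := by
  rw [spectralTerm, pow_mul]
  refine mul_nonneg ?_ (by positivity)
  split_ifs <;> norm_num

theorem spectralTerm_le (n : ℕ) {M : ℕ} (hM : 0 < M) (k : ℕ) :
    spectralTerm n M k ≤ 2 * Real.pi ^ 2 * (k / M : ℝ) ^ 2 * Real.exp (-(4 * n * (k / M : ℝ) ^ 2)) := by
  have hMr : (0 : ℝ) < M := by exact_mod_cast hM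
  by_cases hk : 2 * k ≤ M
  · have hk' : 2 * (k : ℝ) ≤ M := by exact_mod_cast hk
    have hk2 : (k : ℝ) / M ≤ 1 / 2 := by rw [div_le_iff₀ hMr]; linarith
    set r : ℝ := (k : ℝ) / M with hr
    have hr0 : 0 ≤ r := by positivity
    have e : Real.pi * k / M = Real.pi * r := by rw [hr]; ring
    have hpi := Real.pi_pos
    have habs : |Real.pi * r| ≤ Real.pi := by rw [abs_of_nonneg (by positivity)]; nlinarith
    have hcos0 : 0 ≤ Real.cos (Real.pi * r) :=
      Real.cos_nonneg_of_mem_Icc ⟨by nlinarith, by nlinarith⟩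
    have hcos : Real.cos (Real.pi * r) ≤ Real.exp (-(2 * r ^ 2)) := by
      refine (Real.cos_le_one_sub_mul_cos_sq habs).trans (le_trans (le_of_eq ?_) (Real.add_one_le_exp _))
      field_simp
      ring
    have hsin : Real.sin (Real.pi * r) ^ 2 ≤ (Real.pi * r) ^ 2 := by
      refine pow_le_pow_left₀ (Real.sin_nonneg_of_nonneg_of_le_pi (by positivity) (by nlinarith)) ?_ 2
      exact Real.sin_le (by positivity)
    rw [spectralTerm, e]
    calc _ ≤ 2 * (Real.exp (-(2 * r ^ 2)) ^ (2 * n) * (Real.pi * r) ^ 2) := by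
          gcongr
          split_ifs <;> norm_num
      _ = _ := by
          rw [← Real.exp_nat_mul]
          push_cast
          rw [show 2 * (n : ℝ) * -(2 * r ^ 2) = -(4 * n * r ^ 2) by ring]
          ring
  · rw [spectralTerm, if_neg hk, if_neg (by omega), add_zero, zero_mul]
    positivity

theorem exp_neg_le (p : ℕ) {x : ℝ} (hx : 0 < x) : Real.exp (-x) ≤ p.factorial * (1 / x) ^ p := by
  have := Real.pow_div_factorial_le_exp x hx.le p
  rw [div_le_iff₀ (by positivity)] at this
  rw [Real.exp_neg, one_div, inv_pow, ← div_eq_mul_inv, inv_eq_one_div, div_le_div_iff₀ (Real.exp_pos _) (by positivity)]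
  linarith

/-- Rapid decay on the scale `M ≪ √n`. -/
theorem pathFraction_small {p : ℕ} (hp : 2 ≤ p) : ∃ K : ℝ, 0 ≤ K ∧ ∀ n M : ℕ, 0 < n → 0 < M →
    ((n : ℝ) + 1) ^ (3 / 2 : ℝ) * pathFraction n M
      ≤ K * (M / Real.sqrt ((n : ℝ) + 1)) ^ (2 * p - 3) := by
  have hsum : Summable fun k : ℕ => 1 / (k : ℝ) ^ 2 := Real.summable_one_div_nat_pow.2 (by norm_num)
  refine ⟨Real.pi ^ 2 * p.factorial * ∑' k : ℕ, 1 / (k : ℝ) ^ 2,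
    mul_nonneg (by positivity) (tsum_nonneg fun i => by positivity), fun n M hn hM => ?_⟩
  have hMr : (0 : ℝ) < M := by exact_mod_cast hM
  set N : ℝ := (n : ℝ) + 1 with hN
  have hN0 : 0 < N := by positivity
  have hnN : N ≤ 2 * n := by
    have : (1 : ℝ) ≤ n := by exact_mod_cast hn
    linarith
  obtain ⟨q, rfl⟩ := Nat.exists_eq_add_of_le hp
  have hr : N ^ (3 / 2 : ℝ) = N * Real.sqrt N := by
    rw [show (3 / 2 : ℝ) = 1 + 1 / 2 by norm_num, Real.rpow_add hN0, Real.rpow_one, Real.sqrt_eq_rpow]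
  have hs : 0 < Real.sqrt N := Real.sqrt_pos.2 hN0
  have hs2 : N = Real.sqrt N ^ 2 := (Real.sq_sqrt hN0.le).symm
  set r : ℝ := M / Real.sqrt N with hrr
  have hr0 : 0 < r := by positivity
  have hterm : ∀ k : ℕ, spectralTerm n M k ≤
      2 * Real.pi ^ 2 / M ^ 2 * ((2 + q).factorial * (r ^ 2) ^ (2 + q)) * (1 / (k : ℝ) ^ 2) := by
    intro k
    rcases Nat.eq_zero_or_pos k with rfl | hk
    · simp [spectralTerm]
    have hk1 : (1 : ℝ) ≤ k := by exact_mod_cast hk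
    have hx : (k : ℝ) ^ 2 / r ^ 2 ≤ 4 * n * (k / M : ℝ) ^ 2 := by
      have : (k : ℝ) ^ 2 / r ^ 2 = N * (k / M : ℝ) ^ 2 := by
        rw [hrr]; field_simp; rw [← hs2]
      rw [this]; gcongr; linarith
    have h1 := exp_neg_le (2 + q) (x := (k : ℝ) ^ 2 / r ^ 2) (by positivity)
    have h2 : Real.exp (-(4 * n * (k / M : ℝ) ^ 2)) ≤ Real.exp (-((k : ℝ) ^ 2 / r ^ 2)) := by
      gcongr
    have h3 : (1 / ((k : ℝ) ^ 2 / r ^ 2)) ^ (2 + q) ≤ (r ^ 2) ^ (2 + q) * (1 / (k : ℝ) ^ 4) := by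
      rw [one_div_div, div_pow, div_eq_mul_one_div]
      gcongr
      rw [← pow_mul]
      exact pow_le_pow_right₀ hk1 (by omega)
    calc _ ≤ _ := spectralTerm_le n hM k
      _ ≤ 2 * Real.pi ^ 2 * (k / M : ℝ) ^ 2 * ((2 + q).factorial * ((r ^ 2) ^ (2 + q) * (1 / (k : ℝ) ^ 4))) := by
          gcongr
          exact h2.trans (h1.trans (by gcongr))
      _ = _ := by field_simp
  have hle : ∑' k, spectralTerm n M k ≤ ∑' k : ℕ,
      2 * Real.pi ^ 2 / M ^ 2 * ((2 + q).factorial * (r ^ 2) ^ (2 + q)) * (1 / (k : ℝ) ^ 2) :=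
    Summable.tsum_le_tsum hterm
      (Summable.of_nonneg_of_le (spectralTerm_nonneg n M) hterm (hsum.mul_left _)) (hsum.mul_left _)
  rw [tsum_mul_left] at hle
  rw [pathFraction_eq_tsum n hM, hr]
  have e : 2 * (2 + q) - 3 = 2 * q + 1 := by omega
  rw [e]
  calc _ ≤ N * Real.sqrt N * ((2 * Real.pi ^ 2 / M ^ 2 * ((2 + q).factorial * (r ^ 2) ^ (2 + q)) *
          ∑' k : ℕ, 1 / (k : ℝ) ^ 2) / (2 * M)) := by gcongr
    _ = _ := by
      have hM2 : (M : ℝ) = r * Real.sqrt N := by rw [hrr]; field_simp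
      rw [hM2]
      nth_rewrite 1 [hs2]
      field_simp
      ring

/-- The rescaled number of walks confined to a strip of width `y √N`, where `N = n + 1`. -/
noncomputable def scaledFraction (n : ℕ) (y : ℝ) : ℝ :=
  ((n : ℝ) + 1) ^ (3 / 2 : ℝ) * pathFraction n (⌊y * Real.sqrt ((n : ℝ) + 1)⌋₊ + 2)

/-- The limiting profile of `scaledFraction`. -/
noncomputable def limitProfile (y : ℝ) : ℝ :=
  Real.pi ^ 2 / y ^ 3 * ∑' k : ℕ, (k : ℝ) ^ 2 * Real.exp (-(Real.pi ^ 2 * k ^ 2 / y ^ 2))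

theorem tendsto_sqrt_add_one : Tendsto (fun n : ℕ => Real.sqrt ((n : ℝ) + 1)) atTop atTop :=
  Real.tendsto_sqrt_atTop.comp (tendsto_atTop_add_const_right _ _ tendsto_natCast_atTop_atTop)

theorem tendsto_width_div {y : ℝ} (hy : 0 < y) :
    Tendsto (fun n : ℕ => ((⌊y * Real.sqrt ((n : ℝ) + 1)⌋₊ + 2 : ℕ) : ℝ) / Real.sqrt ((n : ℝ) + 1))
      atTop (nhds y) := by
  have h1 := (tendsto_nat_floor_mul_div_atTop hy.le).comp tendsto_sqrt_add_one
  have h2 : Tendsto (fun n : ℕ => 2 / Real.sqrt ((n : ℝ) + 1)) atTop (nhds 0) :=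
    tendsto_const_nhds.div_atTop tendsto_sqrt_add_one
  have := h1.add h2
  rw [add_zero] at this
  refine this.congr fun n => ?_
  simp only [Function.comp]
  push_cast
  ring

theorem tendsto_scaledFraction {y : ℝ} (hy : 0 < y) :
    Tendsto (fun n => scaledFraction n y) atTop (nhds (limitProfile y)) := by
  set M : ℕ → ℕ := fun n => ⌊y * Real.sqrt ((n : ℝ) + 1)⌋₊ + 2 with hM
  set s : ℕ → ℝ := fun n => Real.sqrt ((n : ℝ) + 1) with hs
  have hspos : ∀ n, 0 < s n := fun n => Real.sqrt_pos.2 (by positivity)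
  have hs2 : ∀ n, s n ^ 2 = n + 1 := fun n => Real.sq_sqrt (by positivity)
  have hMpos : ∀ n, 0 < M n := fun n => Nat.succ_pos _
  have hMpos' : ∀ n, (0 : ℝ) < M n := fun n => by exact_mod_cast hMpos n
  have hsT : Tendsto s atTop atTop := tendsto_sqrt_add_one
  have hr : Tendsto (fun n => (M n : ℝ) / s n) atTop (nhds y) := tendsto_width_div hy
  have hMT : Tendsto (fun n => (M n : ℝ)) atTop atTop := by
    have := hr.pos_mul_atTop hy hsT
    refine this.congr fun n => ?_
    field_simp [(hspos n).ne']
  have hMT' : Tendsto M atTop atTop := tendsto_natCast_atTop_iff.1 hMT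
  have hform : ∀ n, scaledFraction n y = 1 / (2 * (M n / s n) ^ 3) * ∑' k, (M n : ℝ) ^ 2 * spectralTerm n (M n) k := by
    intro n
    have hr : ((n : ℝ) + 1) ^ (3 / 2 : ℝ) = s n ^ 3 := by
      rw [show (3 / 2 : ℝ) = 1 + 1 / 2 by norm_num, Real.rpow_add (by positivity), Real.rpow_one,
        ← Real.sqrt_eq_rpow, ← hs2 n]
      simp only [hs]
      rw [Real.sqrt_sq (Real.sqrt_nonneg _)]
      ring
    rw [scaledFraction, hr, pathFraction_eq_tsum n (hMpos n), tsum_mul_left]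
    have := (hMpos' n).ne'
    have := (hspos n).ne'
    change _ * (_ / (2 * (M n : ℝ))) = _
    field_simp
  have hterm : ∀ k : ℕ, Tendsto (fun n => (M n : ℝ) ^ 2 * spectralTerm n (M n) k) atTop
      (nhds (2 * (Real.exp (-(Real.pi * k) ^ 2 / y ^ 2) * (Real.pi * k) ^ 2))) := by
    intro k
    have hsinc : Tendsto (fun n => (M n : ℝ) * Real.sin (Real.pi * k / M n)) atTop (nhds (Real.pi * k)) := by
      have h0 : Tendsto (fun n => Real.pi * k / (M n : ℝ)) atTop (nhds 0) :=
        tendsto_const_nhds.div_atTop hMT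
      have h1 := ((Real.continuous_sinc.tendsto 0).comp h0).const_mul (Real.pi * k)
      rw [Real.sinc_zero, mul_one] at h1
      refine h1.congr fun n => ?_
      have hMn := (hMpos' n).ne'
      rcases Nat.eq_zero_or_pos k with rfl | hk
      · simp
      have hk' : (k : ℝ) ≠ 0 := by exact_mod_cast hk.ne'
      have hpi := Real.pi_ne_zero
      simp only [Function.comp]
      rw [Real.sinc_of_ne_zero (by positivity)]
      field_simp
    have hns : Tendsto (fun n : ℕ => (n : ℝ) * -(Real.sin (Real.pi * k / M n) ^ 2)) atTop
        (nhds (-(Real.pi * k) ^ 2 / y ^ 2)) := by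
      have h2 : Tendsto (fun n : ℕ => (n : ℝ) / ((n : ℝ) + 1)) atTop (nhds 1) := by
        have h3 : Tendsto (fun n : ℕ => 1 - 1 / ((n : ℝ) + 1)) atTop (nhds (1 - 0)) :=
          tendsto_const_nhds.sub tendsto_one_div_add_atTop_nhds_zero_nat
        rw [sub_zero] at h3
        refine h3.congr fun n => ?_
        field_simp; ring
      have h4 := ((hsinc.pow 2).div (hr.pow 2) (by positivity)).mul h2
      have h5 := h4.neg
      rw [mul_one, ← neg_div] at h5
      refine h5.congr fun n => ?_
      have := (hMpos' n).ne'
      simp only [Pi.div_apply]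
      rw [div_pow, hs2 n]
      field_simp
    have hpow := Real.tendsto_one_add_pow_exp_of_tendsto hns
    have hall := (hpow.mul (hsinc.pow 2)).const_mul 2
    refine hall.congr' ?_
    filter_upwards [hMT'.eventually_gt_atTop (2 * k)] with n hn
    rw [spectralTerm, if_pos hn.le, if_pos hn, pow_mul, Real.cos_sq']
    ring
  have hsum : Summable fun k : ℕ => 1 / (k : ℝ) ^ 2 := Real.summable_one_div_nat_pow.2 (by norm_num)
  have hbound : ∀ᶠ n : ℕ in atTop, ∀ k : ℕ, ‖(M n : ℝ) ^ 2 * spectralTerm n (M n) k‖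
      ≤ 2 * Real.pi ^ 2 * (2 * ((y + 1) ^ 2) ^ 2) * (1 / (k : ℝ) ^ 2) := by
    filter_upwards [hr.eventually_lt_const (lt_add_one y), eventually_ge_atTop 1] with n hn hn1 k
    rw [Real.norm_of_nonneg (mul_nonneg (by positivity) (spectralTerm_nonneg _ _ _))]
    rcases Nat.eq_zero_or_pos k with rfl | hk
    · simp [spectralTerm]
    have hk1 : (1 : ℝ) ≤ k := by exact_mod_cast hk
    have hMn := hMpos' n
    have hn1' : (1 : ℝ) ≤ n := by exact_mod_cast hn1
    have hx : (k : ℝ) ^ 2 / (y + 1) ^ 2 ≤ 4 * n * (k / M n : ℝ) ^ 2 := by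
      have h1 : (k : ℝ) ^ 2 / (y + 1) ^ 2 ≤ (k : ℝ) ^ 2 / (M n / s n) ^ 2 := by
        have := hspos n
        gcongr
      refine h1.trans ?_
      rw [div_pow, hs2 n]
      have : (k : ℝ) ^ 2 / ((M n : ℝ) ^ 2 / (n + 1)) = (n + 1) * (k / M n : ℝ) ^ 2 := by
        field_simp
      rw [this]; gcongr; linarith
    have h1 := exp_neg_le 2 (x := (k : ℝ) ^ 2 / (y + 1) ^ 2) (by positivity)
    have h2 : Real.exp (-(4 * n * (k / M n : ℝ) ^ 2)) ≤ Real.exp (-((k : ℝ) ^ 2 / (y + 1) ^ 2)) := by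
      gcongr
    calc _ ≤ (M n : ℝ) ^ 2 * (2 * Real.pi ^ 2 * (k / M n : ℝ) ^ 2 *
            ((2).factorial * (1 / ((k : ℝ) ^ 2 / (y + 1) ^ 2)) ^ 2)) := by
          gcongr
          refine (spectralTerm_le n (hMpos n) k).trans ?_
          gcongr
          exact h2.trans h1
      _ = _ := by
          simp only [Nat.factorial_two, Nat.cast_ofNat]
          field_simp
  have htsum := tendsto_tsum_of_dominated_convergence (hsum.mul_left _) hterm hbound
  have hfin := ((tendsto_const_nhds (x := (1 : ℝ))).div ((hr.pow 3).const_mul 2) (by positivity)).mul htsum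
  have e : limitProfile y = 1 / (2 * y ^ 3) *
      ∑' k : ℕ, 2 * (Real.exp (-(Real.pi * k) ^ 2 / y ^ 2) * (Real.pi * k) ^ 2) := by
    rw [limitProfile, ← tsum_mul_left, ← tsum_mul_left]
    refine tsum_congr fun k => ?_
    rw [mul_pow, neg_div]
    field_simp
  rw [e]
  exact hfin.congr fun n => (hform n).symm

theorem cosMean_mem (n M : ℕ) : 0 ≤ cosMean n M ∧ cosMean n M ≤ 1 := by
  have h : ∀ k : ℕ, 0 ≤ Real.cos (Real.pi * k / M) ^ (2 * n) ∧ Real.cos (Real.pi * k / M) ^ (2 * n) ≤ 1 := by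
    intro k
    rw [pow_mul]
    exact ⟨by positivity, pow_le_one₀ (by positivity) (Real.cos_sq_le_one _)⟩
  refine ⟨div_nonneg (Finset.sum_nonneg fun k _ => (h k).1) (by positivity), ?_⟩
  refine div_le_one_of_le₀ ?_ (by positivity)
  refine (Finset.sum_le_sum fun k _ => (h k).2).trans ?_
  simp

theorem abs_pathFraction_le (n M : ℕ) : |pathFraction n M| ≤ 1 / 2 := by
  have h1 := cosMean_mem n M
  have h2 := cosMean_mem (n + 1) M
  rw [pathFraction, abs_le]
  constructor <;> linarith [h1.1, h1.2, h2.1, h2.2]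

/-- The contribution of height `m + 1` to the coefficient of index `n + 1`, divided by
`4 ^ (n + 1)`. -/
noncomputable def heightTerm (α : ℝ) (n m : ℕ) : ℝ :=
  ((m : ℝ) + 1) ^ α * (pathFraction n (m + 3) - pathFraction n (m + 2))

theorem heightTerm_eq_zero (α : ℝ) {n m : ℕ} (h : n ≤ m) : heightTerm α n m = 0 := by
  rw [heightTerm, pathFraction_stable (by omega), pathFraction_stable (by omega), sub_self, mul_zero]

theorem abs_heightTerm_le (α : ℝ) (n m : ℕ) : |heightTerm α n m| ≤ (n : ℝ) ^ ⌈|α|⌉₊ := by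
  rcases Nat.lt_or_ge m n with h | h
  · have hm : (1 : ℝ) ≤ (m : ℝ) + 1 := by linarith [(Nat.cast_nonneg m : (0 : ℝ) ≤ m)]
    have h1 : ((m : ℝ) + 1) ^ α ≤ (n : ℝ) ^ ⌈|α|⌉₊ := by
      calc ((m : ℝ) + 1) ^ α ≤ ((m : ℝ) + 1) ^ (⌈|α|⌉₊ : ℝ) :=
            Real.rpow_le_rpow_of_exponent_le hm ((le_abs_self α).trans (Nat.le_ceil _))
        _ ≤ (n : ℝ) ^ ⌈|α|⌉₊ := by
            rw [Real.rpow_natCast]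
            gcongr
            exact_mod_cast h
    have h2 : |pathFraction n (m + 3) - pathFraction n (m + 2)| ≤ 1 := by
      refine (abs_sub _ _).trans ?_
      linarith [abs_pathFraction_le n (m + 3), abs_pathFraction_le n (m + 2)]
    rw [heightTerm, abs_mul, abs_of_pos (by positivity)]
    calc _ ≤ (n : ℝ) ^ ⌈|α|⌉₊ * 1 := by gcongr
      _ = _ := mul_one _
  · rw [heightTerm_eq_zero α h, abs_zero]; positivity

theorem coeff_eq {α : ℝ} {Z : ℕ → ℝ} (hZ : IsCoeffSeq α Z) (n : ℕ) :
    Z (n + 1) = 4 ^ (n + 1) * ∑ m ∈ Finset.range n, heightTerm α n m := by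
  let b : ℕ → ℝ := fun N => match N with
    | 0 => 0
    | n + 1 => 4 ^ (n + 1) * ∑ m ∈ Finset.range n, heightTerm α n m
  suffices h : Z = b by rw [h]
  refine powerSeries_coeff_unique (by norm_num : (0 : ℝ) < 1 / 4) (f := fun g =>
    ∑' m : ℕ, ((m : ℝ) + 1) ^ α * (X (m + 2) g - X (m + 1) g)) hZ fun g h0 h1 => ?_
  have hb : HasSum (fun n => b (n + 1) * g ^ (n + 1))
      (∑' m : ℕ, ((m : ℝ) + 1) ^ α * (X (m + 2) g - X (m + 1) g)) := by
    let f : ℕ × ℕ → ℝ := fun q => 4 ^ (q.1 + 1) * heightTerm α q.1 q.2 * g ^ (q.1 + 1)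
    have hfin : ∀ n, HasSum (fun m => f (n, m)) (b (n + 1) * g ^ (n + 1)) := by
      intro n
      have : b (n + 1) * g ^ (n + 1) = ∑ m ∈ Finset.range n, f (n, m) := by
        simp only [b, f, Finset.mul_sum, Finset.sum_mul]
      rw [this]
      refine hasSum_sum_of_ne_finset_zero fun m hm => ?_
      simp only [f]
      rw [heightTerm_eq_zero α (by simpa using hm)]; ring
    have hcol : ∀ m, HasSum (fun n => f (n, m)) (((m : ℝ) + 1) ^ α * (X (m + 2) g - X (m + 1) g)) := by
      intro m
      have h := ((hasSum_X h0 h1 (m + 2)).sub (hasSum_X h0 h1 (m + 1))).mul_left (((m : ℝ) + 1) ^ α)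
      have e : (fun n => f (n, m)) = fun n => ((m : ℝ) + 1) ^ α *
          (4 ^ (n + 1) * pathFraction n (m + 2 + 1) * g ^ (n + 1) -
            4 ^ (n + 1) * pathFraction n (m + 1 + 1) * g ^ (n + 1)) := by
        funext n
        simp only [f, heightTerm]
        ring
      rw [e]
      exact h
    have hsum : Summable f := by
      rw [← summable_norm_iff]
      rw [summable_prod_of_nonneg fun _ => norm_nonneg _]
      refine ⟨fun n => (hfin n).summable.norm, ?_⟩
      have hg : ‖4 * g‖ < 1 := by rw [Real.norm_of_nonneg (by positivity)]; linarith
      have hs := (summable_pow_mul_geometric_of_norm_lt_one (⌈|α|⌉₊ + 1) hg).mul_right (4 * g)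
      refine Summable.of_nonneg_of_le (fun n => tsum_nonneg fun m => norm_nonneg _) (fun n => ?_) hs
      rw [tsum_eq_sum (s := Finset.range n)]
      · refine (Finset.sum_le_card_nsmul _ _ ((n : ℝ) ^ ⌈|α|⌉₊ * (4 * g) ^ (n + 1)) fun m _ => ?_).trans ?_
        · simp only [f]
          rw [norm_mul, norm_mul, Real.norm_eq_abs, Real.norm_eq_abs (heightTerm α n m),
            Real.norm_eq_abs, abs_of_pos (by positivity), abs_of_pos (by positivity : 0 < g ^ (n + 1)), mul_pow]
          have := abs_heightTerm_le α n m
          calc _ ≤ 4 ^ (n + 1) * (n : ℝ) ^ ⌈|α|⌉₊ * g ^ (n + 1) := by gcongr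
            _ = _ := by ring
        · rw [Finset.card_range, nsmul_eq_mul]
          exact le_of_eq (by ring)
      · intro m hm
        simp only [f]
        rw [heightTerm_eq_zero α (by simpa using hm)]; simp
    have h2 := hsum.hasSum.prod_fiberwise hfin
    have h3 : ∑' q, f q = ∑' m : ℕ, ((m : ℝ) + 1) ^ α * (X (m + 2) g - X (m + 1) g) := by
      have hsw : Summable fun q : ℕ × ℕ => f (q.2, q.1) := hsum.comp_injective Prod.swap_injective
      have h4 := hsw.hasSum.prod_fiberwise hcol
      rw [h4.tsum_eq]
      exact ((Equiv.prodComm ℕ ℕ).tsum_eq f).symm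
    rwa [h3] at h2
  rw [← hasSum_nat_add_iff' 1]
  simpa [b] using hb

theorem integral_step {a : ℝ} (ha : 0 < a) (α : ℝ) :
    IntegrableOn (fun y : ℝ => y ^ (α - 1) * ((if a ≤ y then 1 else 0) - if 1 < y then 1 else 0))
      (Set.Ioi 0) ∧
    α * ∫ y in Set.Ioi (0 : ℝ), y ^ (α - 1) * ((if a ≤ y then 1 else 0) - if 1 < y then 1 else 0)
      = 1 - a ^ α := by
  have h_int : ∀ {b c : ℝ}, 0 < b → b ≤ c → IntegrableOn (fun y : ℝ => y ^ (α - 1)) (Set.Icc b c) := by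
    intro b c hb hbc
    refine ContinuousOn.integrableOn_Icc fun x hx => ?_
    exact (Real.continuousAt_rpow_const _ _ (Or.inl (hb.trans_le hx.1).ne')).continuousWithinAt
  have hval : ∀ {b c : ℝ}, 0 < b → b ≤ c → α * ∫ y in b..c, y ^ (α - 1) = c ^ α - b ^ α := by
    intro b c hb hbc
    rcases eq_or_ne α 0 with rfl | hα
    · simp
    rw [integral_rpow, sub_add_cancel]
    · field_simp
    · refine Or.inr ⟨fun h => hα (by linarith), ?_⟩
      rw [Set.uIcc_of_le hbc]
      exact fun h => absurd h.1 (not_le.2 hb)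
  rcases le_or_gt a 1 with h | h
  · have e : (fun y : ℝ => y ^ (α - 1) * ((if a ≤ y then (1 : ℝ) else 0) - if 1 < y then 1 else 0))
        = (Set.Icc a 1).indicator fun y => y ^ (α - 1) := by
      funext y
      rw [Set.indicator_apply]
      simp only [Set.mem_Icc]
      split_ifs <;> grind
    have hsub : Set.Icc a 1 ∩ Set.Ioi 0 = Set.Icc a 1 :=
      Set.inter_eq_left.2 fun y hy => ha.trans_le hy.1
    rw [e]
    refine ⟨((h_int ha h).integrable_indicator measurableSet_Icc).integrableOn, ?_⟩
    rw [setIntegral_indicator measurableSet_Icc, Set.inter_comm, hsub, integral_Icc_eq_integral_Ioc,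
      ← intervalIntegral.integral_of_le h, hval ha h, Real.one_rpow]
  · have e : (fun y : ℝ => y ^ (α - 1) * ((if a ≤ y then (1 : ℝ) else 0) - if 1 < y then 1 else 0))
        = fun y => - (Set.Ioo 1 a).indicator (fun y => y ^ (α - 1)) y := by
      funext y
      rw [Set.indicator_apply]
      simp only [Set.mem_Ioo]
      split_ifs <;> grind
    have hsub : Set.Ioo 1 a ∩ Set.Ioi 0 = Set.Ioo 1 a :=
      Set.inter_eq_left.2 fun y hy => zero_lt_one.trans hy.1
    rw [e]
    have hi := (h_int one_pos h.le).mono_set Set.Ioo_subset_Icc_self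
    refine ⟨(hi.integrable_indicator measurableSet_Ioo).neg.integrableOn, ?_⟩
    rw [integral_neg, setIntegral_indicator measurableSet_Ioo, Set.inter_comm, hsub,
      ← integral_Ioc_eq_integral_Ioo, ← intervalIntegral.integral_of_le h.le, mul_neg,
      hval one_pos h.le, Real.one_rpow]
    ring

/-- The rescaled stable value. -/
noncomputable def scaledStable (n : ℕ) : ℝ := ((n : ℝ) + 1) ^ (3 / 2 : ℝ) * stableFraction n

/-- `scaledFraction` with its limit at infinity removed on `(1, ∞)`. -/
noncomputable def scaledExcess (n : ℕ) (y : ℝ) : ℝ :=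
  scaledFraction n y - if 1 < y then scaledStable n else 0

theorem pathFraction_two {n : ℕ} (hn : 0 < n) : pathFraction n 2 = 0 := by
  have : Real.cos (Real.pi / 2) ^ (2 * n) = 0 := by
    rw [Real.cos_pi_div_two, zero_pow (by omega)]
  rw [pathFraction_eq_sum_sin]
  simp [Finset.sum_range_succ, hn.ne']

theorem scaledExcess_eq {n : ℕ} (hn : 0 < n) {y : ℝ} (hy : 0 < y) :
    scaledExcess n y = ∑ m ∈ Finset.range n, (((n : ℝ) + 1) ^ (3 / 2 : ℝ) *
      (pathFraction n (m + 3) - pathFraction n (m + 2))) *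
        ((if ((m : ℝ) + 1) / Real.sqrt ((n : ℝ) + 1) ≤ y then 1 else 0) - if 1 < y then 1 else 0) := by
  set s := Real.sqrt ((n : ℝ) + 1) with hs
  have hs0 : 0 < s := Real.sqrt_pos.2 (by positivity)
  have htel : ∀ K, ∑ m ∈ Finset.range K, (pathFraction n (m + 3) - pathFraction n (m + 2))
      = pathFraction n (K + 2) := by
    intro K
    have := Finset.sum_range_sub (fun m => pathFraction n (m + 2)) K
    simp only [zero_add, pathFraction_two hn, sub_zero] at this
    exact this
  have hcond : ∀ m : ℕ, ((m : ℝ) + 1) / s ≤ y ↔ m < ⌊y * s⌋₊ := by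
    intro m
    rw [div_le_iff₀ hs0, ← Nat.succ_le_iff, Nat.le_floor_iff (by positivity)]
    push_cast
    rfl
  have h1 : ∑ m ∈ Finset.range n, (pathFraction n (m + 3) - pathFraction n (m + 2)) *
      (if ((m : ℝ) + 1) / s ≤ y then 1 else 0) = pathFraction n (⌊y * s⌋₊ + 2) := by
    simp only [hcond, mul_ite, mul_one, mul_zero]
    rw [← Finset.sum_filter]
    have : (Finset.range n).filter (fun m => m < ⌊y * s⌋₊) = Finset.range (min n ⌊y * s⌋₊) := by
      ext m; simp
    rw [this, htel]
    rcases le_total n ⌊y * s⌋₊ with h | h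
    · rw [min_eq_left h, pathFraction_stable (by omega), pathFraction_stable (by omega)]
    · rw [min_eq_right h]
  have hsplit : ∀ c d i j : ℝ, c * d * (i - j) = c * (d * i) - d * (c * j) := by intros; ring
  simp only [hsplit]
  rw [Finset.sum_sub_distrib, ← Finset.mul_sum, ← Finset.sum_mul, h1, htel,
    scaledExcess, scaledFraction, scaledStable, pathFraction_stable (by omega : n + 1 < n + 2)]
  split_ifs <;> ring

theorem coeff_eq_integral {α : ℝ} {Z : ℕ → ℝ} (hZ : IsCoeffSeq α Z) {n : ℕ} (hn : 0 < n) :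
    Z (n + 1) / (((n : ℝ) + 1) ^ ((α - 3) / 2) * 4 ^ (n + 1))
      = scaledStable n - α * ∫ y in Set.Ioi (0 : ℝ), y ^ (α - 1) * scaledExcess n y := by
  set s := Real.sqrt ((n : ℝ) + 1) with hs
  have hN : (0 : ℝ) < n + 1 := by positivity
  have hs0 : 0 < s := Real.sqrt_pos.2 hN
  have e : ∫ y in Set.Ioi (0 : ℝ), y ^ (α - 1) * scaledExcess n y
      = ∑ m ∈ Finset.range n, (((n : ℝ) + 1) ^ (3 / 2 : ℝ) *
      (pathFraction n (m + 3) - pathFraction n (m + 2))) * ∫ y in Set.Ioi (0 : ℝ), y ^ (α - 1) *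
        ((if ((m : ℝ) + 1) / s ≤ y then 1 else 0) - if 1 < y then 1 else 0) := by
    simp_rw [← integral_const_mul]
    rw [← integral_finsetSum]
    · refine setIntegral_congr_fun measurableSet_Ioi fun y hy => ?_
      rw [scaledExcess_eq hn hy, Finset.mul_sum]
      exact Finset.sum_congr rfl fun m _ => by ring
    · exact fun m _ => (integral_step (by positivity) α).1.const_mul _
  have htel : ∑ m ∈ Finset.range n, (pathFraction n (m + 3) - pathFraction n (m + 2))
      = stableFraction n := by
    have := Finset.sum_range_sub (fun m => pathFraction n (m + 2)) n
    simp only [zero_add, pathFraction_two hn, sub_zero] at this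
    rw [← pathFraction_stable (by omega : n + 1 < n + 2), ← this]
  have e2 : α * ∫ y in Set.Ioi (0 : ℝ), y ^ (α - 1) * scaledExcess n y
      = scaledStable n - ((n : ℝ) + 1) ^ (3 / 2 : ℝ) * s ^ (-α) * ∑ m ∈ Finset.range n, heightTerm α n m := by
    rw [e, Finset.mul_sum, scaledStable, ← htel, Finset.mul_sum, Finset.mul_sum, ← Finset.sum_sub_distrib]
    refine Finset.sum_congr rfl fun m _ => ?_
    rw [mul_left_comm, (integral_step (by positivity) α).2, heightTerm,
      Real.div_rpow (by positivity) hs0.le, Real.rpow_neg hs0.le]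
    ring
  have e3 : ((n : ℝ) + 1) ^ (3 / 2 : ℝ) * s ^ (-α) = (((n : ℝ) + 1) ^ ((α - 3) / 2))⁻¹ := by
    rw [hs, Real.sqrt_eq_rpow, ← Real.rpow_mul hN.le, ← Real.rpow_add hN, ← Real.rpow_neg hN.le]
    congr 1
    ring
  rw [e2, e3, coeff_eq hZ n]
  field_simp
  ring

/-- A bound by `C * min (y ^ p) (y ^ (-p))`. -/
def RapidBound (C : ℝ) (p : ℕ) (f : ℝ → ℝ) : Prop :=
  (∀ y, 0 < y → y ≤ 1 → |f y| ≤ C * y ^ p) ∧ (∀ y, 1 < y → |f y| ≤ C * (1 / y) ^ p)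

theorem pathFraction_nonneg (n M : ℕ) : 0 ≤ pathFraction n M := by
  rw [pathFraction_eq_sum_sin]
  refine div_nonneg (Finset.sum_nonneg fun k _ => ?_) (by positivity)
  rw [pow_mul]; positivity

theorem scaledExcess_bound (p : ℕ) :
    ∃ C, 0 ≤ C ∧ ∀ n : ℕ, 0 < n → RapidBound C p (scaledExcess n) := by
  obtain ⟨K₁, hK₁, h₁⟩ := pathFraction_small (p := p + 2) (by omega)
  obtain ⟨K₂, hK₂, h₂⟩ := pathFraction_tail (p := p + 1) (by omega)
  refine ⟨K₁ * 3 ^ (2 * p + 1) + K₂, by positivity, fun n hn => ⟨fun y hy hy1 => ?_, fun y hy1 => ?_⟩⟩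
  · set s := Real.sqrt ((n : ℝ) + 1) with hs
    have hs0 : 0 < s := Real.sqrt_pos.2 (by positivity)
    rw [scaledExcess, if_neg (not_lt.2 hy1), sub_zero, scaledFraction, ← hs]
    rw [abs_of_nonneg (mul_nonneg (by positivity) (pathFraction_nonneg _ _))]
    rcases lt_or_ge (y * s) 1 with h | h
    · rw [Nat.floor_eq_zero.2 h, zero_add, pathFraction_two hn, mul_zero]
      positivity
    · refine (h₁ n _ hn (Nat.succ_pos _)).trans ?_
      have hM : ((⌊y * s⌋₊ + 2 : ℕ) : ℝ) / s ≤ 3 * y := by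
        rw [div_le_iff₀ hs0]
        have := Nat.floor_le (by positivity : 0 ≤ y * s)
        push_cast
        linarith
      rw [show 2 * (p + 2) - 3 = 2 * p + 1 by omega]
      calc _ ≤ K₁ * (3 * y) ^ (2 * p + 1) := by gcongr
        _ = K₁ * 3 ^ (2 * p + 1) * y ^ (2 * p + 1) := by rw [mul_pow]; ring
        _ ≤ (K₁ * 3 ^ (2 * p + 1) + K₂) * y ^ p := by
            refine mul_le_mul (by linarith) (pow_le_pow_of_le_one hy.le hy1 (by omega)) (by positivity) (by positivity)
  · set s := Real.sqrt ((n : ℝ) + 1) with hs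
    have hs0 : 0 < s := Real.sqrt_pos.2 (by positivity)
    have hs2 : s ^ 2 = n + 1 := Real.sq_sqrt (by positivity)
    have hy : 0 < y := by linarith
    rw [scaledExcess, if_pos hy1, scaledFraction, scaledStable, ← hs, ← mul_sub, abs_mul,
      abs_of_pos (by positivity)]
    refine (h₂ n _ (Nat.succ_pos _)).trans ?_
    have hM : y * s ≤ ((⌊y * s⌋₊ + 2 : ℕ) : ℝ) := by
      have := Nat.lt_floor_add_one (y * s)
      push_cast
      linarith
    have hM2 : ((n : ℝ) + 1) / ((⌊y * s⌋₊ + 2 : ℕ) : ℝ) ^ 2 ≤ (1 / y) ^ 2 := by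
      rw [← hs2]
      calc _ ≤ s ^ 2 / (y * s) ^ 2 := by gcongr
        _ = _ := by field_simp
    have hy' : 1 / y ≤ 1 := by rw [div_le_one hy]; exact hy1.le
    calc _ ≤ K₂ * ((1 / y) ^ 2) ^ (p + 1) := by gcongr
      _ ≤ (K₁ * 3 ^ (2 * p + 1) + K₂) * (1 / y) ^ p := by
        rw [← pow_mul]
        refine mul_le_mul (by linarith [show 0 ≤ K₁ * 3 ^ (2 * p + 1) by positivity])
          (pow_le_pow_of_le_one (by positivity) hy' (by omega)) (by positivity) (by positivity)

theorem RapidBound.norm_le {C : ℝ} {p : ℕ} {f : ℝ → ℝ} (h : RapidBound C p f) (hC : 0 ≤ C) {α : ℝ}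
    (hp : |α| + 1 ≤ p) {y : ℝ} (hy : 0 < y) :
    ‖y ^ (α - 1) * f y‖ ≤ C * if y ≤ 1 then 1 else y ^ (-2 : ℝ) := by
  have hα := abs_le.1 (le_refl |α|)
  rw [norm_mul, Real.norm_of_nonneg (by positivity), Real.norm_eq_abs]
  split_ifs with h1
  · calc _ ≤ y ^ (α - 1) * (C * y ^ (p : ℝ)) := by
          rw [Real.rpow_natCast]; gcongr; exact h.1 y hy h1
      _ = C * y ^ (α - 1 + p) := by rw [Real.rpow_add hy]; ring
      _ ≤ C * 1 := by
          gcongr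
          exact Real.rpow_le_one hy.le h1 (by linarith)
  · have h1 := not_le.1 h1
    calc _ ≤ y ^ (α - 1) * (C * y ^ (-(p : ℝ))) := by
          gcongr
          refine (h.2 y h1).trans (le_of_eq ?_)
          rw [Real.rpow_neg hy.le, Real.rpow_natCast, one_div, inv_pow]
      _ = C * y ^ (α - 1 + -p) := by rw [Real.rpow_add hy]; ring
      _ ≤ _ := by
          gcongr
          · exact h1.le
          · linarith

theorem integrableOn_majorant (C : ℝ) :
    IntegrableOn (fun y : ℝ => C * if y ≤ 1 then 1 else y ^ (-2 : ℝ)) (Set.Ioi 0) := by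
  refine Integrable.const_mul ?_ C
  change IntegrableOn (fun y : ℝ => if y ≤ 1 then (1 : ℝ) else y ^ (-2 : ℝ)) (Set.Ioi 0) volume
  rw [← Set.Ioc_union_Ioi_eq_Ioi zero_le_one]
  refine IntegrableOn.union ?_ ?_
  · refine (integrableOn_const (C := (1 : ℝ)) (by simp)).congr_fun (fun y hy => ?_) measurableSet_Ioc
    rw [if_pos hy.2]
  · refine (integrableOn_Ioi_rpow_of_lt (by norm_num : (-2 : ℝ) < -1) one_pos).congr_fun
      (fun y hy => ?_) measurableSet_Ioi
    rw [if_neg (not_le.2 hy)]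

theorem measurable_scaledExcess (n : ℕ) : Measurable (scaledExcess n) := by
  unfold scaledExcess scaledFraction
  refine Measurable.sub (Measurable.const_mul ?_ _) ?_
  · have : Measurable fun y : ℝ => ⌊y * Real.sqrt ((n : ℝ) + 1)⌋₊ :=
      Nat.measurable_floor.comp (measurable_id.mul_const _)
    exact (measurable_from_top (f := fun m : ℕ => pathFraction n (m + 2))).comp this
  · exact Measurable.ite measurableSet_Ioi measurable_const measurable_const

/-- `limitProfile` with the value `L` removed on `(1, ∞)`. -/
noncomputable def limitExcess (L y : ℝ) : ℝ := limitProfile y - if 1 < y then L else 0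

/-- The general limit theorem, valid for every real exponent. -/
theorem exists_limit : ∃ L : ℝ,
    AEStronglyMeasurable (limitExcess L) (volume.restrict (Set.Ioi 0)) ∧
    (∀ p : ℕ, ∃ C, 0 ≤ C ∧ RapidBound C p (limitExcess L)) ∧
    ∀ (α : ℝ) (Z : ℕ → ℝ), IsCoeffSeq α Z →
      Tendsto (fun N : ℕ => Z N / ((N : ℝ) ^ ((α - 3) / 2) * 4 ^ N)) atTop
        (nhds (L - α * ∫ y in Set.Ioi (0 : ℝ), y ^ (α - 1) * limitExcess L y)) := by
  obtain ⟨L, hL⟩ := tendsto_stableFraction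
  have hlim : ∀ y, 0 < y → Tendsto (fun n => scaledExcess n y) atTop (nhds (limitExcess L y)) := by
    intro y hy
    refine (tendsto_scaledFraction hy).sub ?_
    split_ifs
    · exact hL
    · exact tendsto_const_nhds
  refine ⟨L, ?_, ?_, ?_⟩
  · refine aestronglyMeasurable_of_tendsto_ae atTop
      (fun n => (measurable_scaledExcess n).aestronglyMeasurable) ?_
    exact (ae_restrict_mem measurableSet_Ioi).mono fun y hy => hlim y hy
  · intro p
    obtain ⟨C, hC, h⟩ := scaledExcess_bound p
    refine ⟨C, hC, fun y hy hy1 => ?_, fun y hy1 => ?_⟩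
    · exact le_of_tendsto (hlim y hy).abs
        ((eventually_gt_atTop 0).mono fun n hn => (h n hn).1 y hy hy1)
    · exact le_of_tendsto (hlim y (by linarith)).abs
        ((eventually_gt_atTop 0).mono fun n hn => (h n hn).2 y hy1)
  · intro α Z hZ
    obtain ⟨C, hC, h⟩ := scaledExcess_bound (⌈|α|⌉₊ + 1)
    have hp : |α| + 1 ≤ ((⌈|α|⌉₊ + 1 : ℕ) : ℝ) := by
      push_cast; linarith [Nat.le_ceil |α|]
    have h_int : Tendsto (fun n => ∫ y in Set.Ioi (0 : ℝ), y ^ (α - 1) * scaledExcess n y) atTop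
        (nhds (∫ y in Set.Ioi (0 : ℝ), y ^ (α - 1) * limitExcess L y)) := by
      refine tendsto_integral_filter_of_dominated_convergence
        (fun y : ℝ => C * if y ≤ 1 then 1 else y ^ (-2 : ℝ)) ?_ ?_ (integrableOn_majorant C) ?_
      · exact Eventually.of_forall fun n =>
          ((measurable_id.pow_const _).mul (measurable_scaledExcess n)).aestronglyMeasurable
      · filter_upwards [eventually_gt_atTop 0] with n hn
        exact (ae_restrict_mem measurableSet_Ioi).mono fun y hy => (h n hn).norm_le hC hp hy
      · exact (ae_restrict_mem measurableSet_Ioi).mono fun y hy => (hlim y hy).const_mul _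
    rw [← tendsto_add_atTop_iff_nat 1]
    refine (hL.sub (h_int.const_mul α)).congr' ?_
    filter_upwards [eventually_gt_atTop 0] with n hn
    have := coeff_eq_integral hZ hn
    push_cast
    rw [this, scaledStable]

/-- The `k`-th summand of `y ^ (α - 1) * limitProfile y`. -/
noncomputable def profileTerm (α : ℝ) (k : ℕ) (y : ℝ) : ℝ :=
  y ^ (α - 1) * (Real.pi ^ 2 / y ^ 3 * (((k : ℝ) + 1) ^ 2 *
    Real.exp (-(Real.pi ^ 2 * ((k : ℝ) + 1) ^ 2 / y ^ 2))))

theorem integral_profileTerm {α : ℝ} (hα : α < 0) (k : ℕ) :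
    ∫ y in Set.Ioi (0 : ℝ), profileTerm α k y =
      1 / 2 * Real.Gamma ((3 - α) / 2) * (Real.pi * (k + 1)) ^ (α - 1) := by
  set b : ℝ := Real.pi * (k + 1) with hb
  have hb0 : 0 < b := by positivity
  have h := Real.integral_rpow_mul_exp_neg_mul_Ioi (a := (3 - α) / 2) (r := b ^ 2) (by linarith)
    (by positivity)
  rw [← integral_comp_rpow_Ioi _ (p := -2) (by norm_num)] at h
  have e : ∀ y ∈ Set.Ioi (0 : ℝ), profileTerm α k y = b ^ 2 / 2 *
      ((|(-2 : ℝ)| * y ^ ((-2 : ℝ) - 1)) • ((y ^ (-2 : ℝ)) ^ ((3 - α) / 2 - 1) *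
        Real.exp (-(b ^ 2 * y ^ (-2 : ℝ))))) := by
    intro y hy
    have hy : 0 < y := hy
    rw [profileTerm, smul_eq_mul, ← Real.rpow_mul hy.le, abs_neg, abs_two,
      show α - 1 = (-2 - 1) + (-2 * ((3 - α) / 2 - 1)) + (3 : ℕ) by push_cast; ring,
      Real.rpow_add hy, Real.rpow_add hy, Real.rpow_natCast,
      show Real.pi ^ 2 * ((k : ℝ) + 1) ^ 2 / y ^ 2 = b ^ 2 * y ^ (-2 : ℝ) by
        rw [Real.rpow_neg hy.le, Real.rpow_two, hb]; ring, hb]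
    field_simp
  rw [setIntegral_congr_fun measurableSet_Ioi e, integral_const_mul, h, one_div, Real.inv_rpow (by positivity),
    ← Real.rpow_natCast, ← Real.rpow_mul hb0.le, ← Real.rpow_neg hb0.le,
    show α - 1 = (2 : ℕ) + -((2 : ℕ) * ((3 - α) / 2)) by push_cast; ring, Real.rpow_add hb0]
  ring

theorem summable_pi_rpow {s : ℝ} (hs : s < -1) :
    Summable fun k : ℕ => (Real.pi * ((k : ℝ) + 1)) ^ s := by
  have h := (summable_nat_add_iff 1).2 (Real.summable_nat_rpow.2 hs)
  refine (h.mul_left (Real.pi ^ s)).congr fun k => ?_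
  rw [Real.mul_rpow Real.pi_pos.le (by positivity)]
  push_cast
  rfl

theorem tsum_profileTerm {α y : ℝ} (hy : 0 < y) :
    ∑' k, profileTerm α k y = y ^ (α - 1) * limitProfile y := by
  have hs : Summable fun k : ℕ => (k : ℝ) ^ 2 * Real.exp (-(Real.pi ^ 2 * (k : ℝ) ^ 2 / y ^ 2)) := by
    have h := Real.summable_pow_mul_exp_neg_nat_mul 2 (r := Real.pi ^ 2 / y ^ 2) (by positivity)
    refine h.of_nonneg_of_le (fun k => by positivity) fun k => ?_
    gcongr
    have hk : (k : ℝ) ≤ (k : ℝ) ^ 2 := by exact_mod_cast Nat.le_self_pow two_ne_zero k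
    have : 0 ≤ Real.pi ^ 2 / y ^ 2 := by positivity
    calc _ = -(Real.pi ^ 2 / y ^ 2 * (k : ℝ) ^ 2) := by ring
      _ ≤ _ := by nlinarith
  simp only [profileTerm, tsum_mul_left]
  rw [limitProfile, hs.tsum_eq_zero_add]
  simp

theorem integral_profile {α : ℝ} (hα : α < 0) :
    ∫ y in Set.Ioi (0 : ℝ), y ^ (α - 1) * limitProfile y =
      1 / 2 * Real.Gamma ((3 - α) / 2) * ∑' k : ℕ, (Real.pi * ((k : ℝ) + 1)) ^ (α - 1) := by
  have hG : 0 < Real.Gamma ((3 - α) / 2) := Real.Gamma_pos_of_pos (by linarith)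
  have hI := fun k => integral_profileTerm hα k
  have h_int : ∀ k, Integrable (profileTerm α k) (volume.restrict (Set.Ioi 0)) := fun k =>
    Integrable.of_integral_ne_zero (by rw [hI]; positivity)
  have hnorm : ∀ k, ∫ y in Set.Ioi (0 : ℝ), ‖profileTerm α k y‖ =
      ∫ y in Set.Ioi (0 : ℝ), profileTerm α k y := fun k =>
    setIntegral_congr_fun measurableSet_Ioi fun y hy => by
      have hy : 0 < y := hy
      exact Real.norm_of_nonneg (by unfold profileTerm; positivity)
  have h := hasSum_integral_of_summable_integral_norm h_int (by
    simp only [hnorm, hI]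
    exact (summable_pi_rpow (by linarith)).mul_left _)
  rw [← tsum_mul_left, ← setIntegral_congr_fun measurableSet_Ioi fun y hy => tsum_profileTerm hy,
    ← h.tsum_eq]
  exact tsum_congr hI

theorem integrableOn_rpow_mul_excess {L : ℝ} (α : ℝ)
    (hm : AEStronglyMeasurable (limitExcess L) (volume.restrict (Set.Ioi 0)))
    (hb : ∀ p : ℕ, ∃ C, 0 ≤ C ∧ RapidBound C p (limitExcess L)) :
    IntegrableOn (fun y => y ^ (α - 1) * limitExcess L y) (Set.Ioi 0) := by
  obtain ⟨p, hp⟩ := exists_nat_ge (|α| + 1)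
  obtain ⟨C, hC, h⟩ := hb p
  refine (integrableOn_majorant C).mono' ?_ ?_
  · exact (by fun_prop : Measurable fun y : ℝ => y ^ (α - 1)).aestronglyMeasurable.mul hm
  · filter_upwards [ae_restrict_mem measurableSet_Ioi] with y hy
    exact h.norm_le hC hp hy

/-- For negative exponents the limit is a value of a zeta series. -/
theorem limit_of_neg {L α : ℝ} (hα : α < 0)
    (hm : AEStronglyMeasurable (limitExcess L) (volume.restrict (Set.Ioi 0)))
    (hb : ∀ p : ℕ, ∃ C, 0 ≤ C ∧ RapidBound C p (limitExcess L)) :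
    L - α * ∫ y in Set.Ioi (0 : ℝ), y ^ (α - 1) * limitExcess L y =
      -α / 2 * Real.Gamma ((3 - α) / 2) * ∑' k : ℕ, (Real.pi * ((k : ℝ) + 1)) ^ (α - 1) := by
  have h1 : IntegrableOn (fun y : ℝ => (Set.Ioi (1 : ℝ)).indicator (fun y => L * y ^ (α - 1)) y)
      (Set.Ioi 0) :=
    ((integrable_indicator_iff measurableSet_Ioi).2
      (Integrable.const_mul (integrableOn_Ioi_rpow_of_lt (by linarith : α - 1 < -1) one_pos) L)).integrableOn
  have e : ∀ y : ℝ, y ^ (α - 1) * limitProfile y = y ^ (α - 1) * limitExcess L y +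
      (Set.Ioi (1 : ℝ)).indicator (fun y => L * y ^ (α - 1)) y := by
    intro y
    by_cases hy : 1 < y
    · rw [Set.indicator_of_mem (show y ∈ Set.Ioi 1 from hy), limitExcess, if_pos hy]; ring
    · rw [Set.indicator_of_notMem (show y ∉ Set.Ioi 1 from hy), limitExcess, if_neg hy]; ring
  have h := integral_profile hα
  simp only [e] at h
  rw [integral_add (integrableOn_rpow_mul_excess α hm hb) h1, setIntegral_indicator measurableSet_Ioi,
    Set.Ioi_inter_Ioi, sup_of_le_right zero_le_one, integral_const_mul,
    integral_Ioi_rpow_of_lt (by linarith) one_pos, Real.one_rpow, sub_add_cancel] at h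
  have hL : L * (-1 / α) * α = -L := by field_simp [hα.ne]
  linear_combination (-α) * h + hL

theorem integral_rpow_div_one_add_sq {β : ℝ} (h1 : -1 < β) (h2 : β < 1) :
    IntegrableOn (fun y : ℝ => y ^ β / (1 + y ^ 2)) (Set.Ioi 0) ∧
    ∫ y in Set.Ioi (0 : ℝ), y ^ β / (1 + y ^ 2) =
      1 / 2 * Real.Gamma ((1 + β) / 2) * Real.Gamma ((1 - β) / 2) := by
  set μ := volume.restrict (Set.Ioi (0 : ℝ)) with hμ
  set f : ℝ → ℝ → ℝ := fun y s => y ^ β * Real.exp (-(s * (1 + y ^ 2))) with hf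
  have hfs : ∀ s, ∀ y : ℝ, f y s = Real.exp (-s) * (y ^ β * Real.exp (-s * y ^ (2 : ℝ))) := by
    intro s y
    rw [mul_left_comm, ← Real.exp_add, Real.rpow_two, hf]
    ring_nf
  have h_int : ∀ s ∈ Set.Ioi (0 : ℝ), Integrable (fun y => f y s) μ := by
    intro s hs
    simp only [hfs]
    exact Integrable.const_mul (integrableOn_rpow_mul_exp_neg_mul_rpow h1 two_pos hs) _
  have hval : ∀ s ∈ Set.Ioi (0 : ℝ), ∫ y, f y s ∂μ =
      1 / 2 * Real.Gamma ((1 + β) / 2) * (Real.exp (-s) * s ^ ((1 - β) / 2 - 1)) := by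
    intro s hs
    simp only [hfs]
    rw [integral_const_mul, hμ, integral_rpow_mul_exp_neg_mul_rpow two_pos h1 hs,
      show -(β + 1) / 2 = (1 - β) / 2 - 1 by ring, add_comm β]
    ring
  have hnorm : ∀ s, ∫ y, ‖f y s‖ ∂μ = ∫ y, f y s ∂μ := fun s =>
    setIntegral_congr_fun measurableSet_Ioi fun y hy => by
      have hy : 0 < y := hy
      exact Real.norm_of_nonneg (by simp only [hf]; positivity)
  have hG := Real.GammaIntegral_convergent (s := (1 - β) / 2) (by linarith)
  have hprod : Integrable (Function.uncurry f) (μ.prod μ) := by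
    refine (integrable_prod_iff' ?_).2 ⟨?_, ?_⟩
    · refine Measurable.aestronglyMeasurable ?_
      simp only [hf, Function.uncurry_def]
      fun_prop
    · filter_upwards [ae_restrict_mem measurableSet_Ioi] with s hs
      exact h_int s hs
    · refine (hG.const_mul (1 / 2 * Real.Gamma ((1 + β) / 2))).congr ?_
      filter_upwards [ae_restrict_mem measurableSet_Ioi] with s hs
      exact ((hnorm s).trans (hval s hs)).symm
  have hs : ∀ y ∈ Set.Ioi (0 : ℝ), ∫ s, f y s ∂μ = y ^ β / (1 + y ^ 2) := by
    intro y _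
    have h := Real.integral_rpow_mul_exp_neg_mul_Ioi (a := 1) (r := 1 + y ^ 2) one_pos (by positivity)
    simp only [sub_self, Real.rpow_zero, one_mul, Real.rpow_one, Real.Gamma_one, mul_one] at h
    simp only [hf]
    rw [integral_const_mul, div_eq_mul_one_div (y ^ β), ← h]
    simp only [mul_comm]
    rfl
  constructor
  · refine (hprod.integral_prod_left).congr ?_
    filter_upwards [ae_restrict_mem measurableSet_Ioi] with y hy
    exact hs y hy
  · rw [← setIntegral_congr_fun measurableSet_Ioi hs, integral_integral_swap hprod,
      setIntegral_congr_fun measurableSet_Ioi hval, integral_const_mul,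
      Real.Gamma_eq_integral (by linarith : 0 < (1 - β) / 2)]

theorem tendsto_rpow_div_one_add_sq_zero {s : ℝ} (hs : 0 < s) :
    Tendsto (fun y : ℝ => y ^ s / (1 + y ^ 2)) (nhdsWithin 0 (Set.Ioi 0)) (nhds 0) := by
  have hc : ContinuousAt (fun y : ℝ => y ^ s / (1 + y ^ 2)) 0 :=
    ContinuousAt.div (Real.continuousAt_rpow_const _ _ (Or.inr hs.le)) (by fun_prop) (by norm_num)
  have h := hc.tendsto
  rw [Real.zero_rpow hs.ne', zero_div] at h
  exact h.mono_left nhdsWithin_le_nhds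

theorem tendsto_rpow_div_one_add_sq_atTop {s : ℝ} (hs : s < 2) :
    Tendsto (fun y : ℝ => y ^ s / (1 + y ^ 2)) atTop (nhds 0) := by
  refine squeeze_zero' ?_ ?_ (tendsto_rpow_neg_atTop (y := 2 - s) (by linarith))
  · filter_upwards [eventually_gt_atTop 0] with y hy
    positivity
  · filter_upwards [eventually_gt_atTop 0] with y hy
    rw [div_le_iff₀ (by positivity)]
    calc y ^ s = y ^ (-(2 - s)) * y ^ (2 : ℝ) := by
          rw [← Real.rpow_add hy]; congr 1; ring
      _ ≤ _ := by rw [Real.rpow_two]; gcongr; linarith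

/-- The remainder of order `n` of `(y² - 1) / (1 + y²)²`. -/
noncomputable def kernelRemainder (n : ℕ) (y : ℝ) : ℝ :=
  (-1) ^ (n + 1) * y ^ (2 * n) * ((2 * n - 1) * (1 + y ^ 2) + 2) / (1 + y ^ 2) ^ 2

theorem kernelRemainder_eq (n : ℕ) (y : ℝ) :
    kernelRemainder n y = (y ^ 2 - 1) / (1 + y ^ 2) ^ 2 -
      ∑ j ∈ Finset.range n, (-1) ^ (j + 1) * (2 * j + 1) * y ^ (2 * j) := by
  have h : (1 + y ^ 2) ≠ 0 := by positivity
  induction n with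
  | zero => simp [kernelRemainder]; ring
  | succ n ih =>
    rw [Finset.sum_range_succ, ← sub_sub, ← ih, kernelRemainder, kernelRemainder]
    field_simp
    push_cast
    ring

theorem hasDerivAt_kernelPrimitive (n : ℕ) (y : ℝ) :
    HasDerivAt (fun y : ℝ => (-1) ^ (n + 1) * y ^ (2 * n + 1) / (1 + y ^ 2)) (kernelRemainder n y) y := by
  have h : (1 + y ^ 2) ≠ 0 := by positivity
  have h1 := ((hasDerivAt_pow (2 * n + 1) y).const_mul ((-1 : ℝ) ^ (n + 1))).div
    ((hasDerivAt_pow 2 y).const_add 1) h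
  refine h1.congr_deriv ?_
  rw [kernelRemainder]
  simp
  ring

theorem abs_kernelRemainder_le (n : ℕ) (y : ℝ) :
    |kernelRemainder n y| ≤ (2 * n + 1) * (y ^ (2 * n) / (1 + y ^ 2)) := by
  have h : 0 < 1 + y ^ 2 := by positivity
  have hp : 0 ≤ y ^ (2 * n) := by rw [pow_mul]; positivity
  rw [kernelRemainder, abs_div, abs_mul, abs_mul, abs_pow, abs_neg, abs_one, one_pow, one_mul,
    abs_of_nonneg hp, abs_of_pos (by positivity : 0 < (1 + y ^ 2) ^ 2), div_le_iff₀ (by positivity)]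
  have e : (2 * (n : ℝ) + 1) * (y ^ (2 * n) / (1 + y ^ 2)) * (1 + y ^ 2) ^ 2 =
    y ^ (2 * n) * ((2 * n + 1) * (1 + y ^ 2)) := by field_simp
  rw [e]
  refine mul_le_mul_of_nonneg_left (abs_le.2 ⟨?_, ?_⟩) hp
  · nlinarith [sq_nonneg y, mul_nonneg (Nat.cast_nonneg (α := ℝ) n) h.le]
  · nlinarith [sq_nonneg y]

theorem integral_rpow_mul_kernelRemainder {α : ℝ} {n : ℕ} (h1 : -(2 * (n : ℝ) + 1) < α)
    (h2 : α < -(2 * (n : ℝ) - 1)) :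
    IntegrableOn (fun y : ℝ => y ^ α * kernelRemainder n y) (Set.Ioi 0) ∧
    ∫ y in Set.Ioi (0 : ℝ), y ^ α * kernelRemainder n y =
      -α / 2 * Real.Gamma ((3 - α) / 2) * Real.Gamma ((α - 1) / 2) := by
  obtain ⟨hi, hv⟩ := integral_rpow_div_one_add_sq (β := α + 2 * n) (by linarith) (by linarith)
  have hpow : ∀ y ∈ Set.Ioi (0 : ℝ), y ^ (α + 2 * n) = y ^ α * y ^ (2 * n) := by
    intro y hy
    rw [Real.rpow_add hy, ← Real.rpow_natCast y (2 * n)]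
    push_cast
    rfl
  have hI : IntegrableOn (fun y : ℝ => y ^ α * kernelRemainder n y) (Set.Ioi 0) := by
    refine Integrable.mono' (hi.const_mul (2 * n + 1)) ?_ ?_
    · refine Measurable.aestronglyMeasurable ?_
      unfold kernelRemainder
      fun_prop
    · filter_upwards [ae_restrict_mem measurableSet_Ioi] with y hy
      rw [norm_mul, Real.norm_of_nonneg (Real.rpow_nonneg (le_of_lt hy) _), Real.norm_eq_abs, hpow y hy]
      calc _ ≤ y ^ α * ((2 * n + 1) * (y ^ (2 * n) / (1 + y ^ 2))) := by
            have : 0 ≤ y ^ α := Real.rpow_nonneg (le_of_lt hy) _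
            gcongr
            exact abs_kernelRemainder_le n y
        _ = _ := by ring
  refine ⟨hI, ?_⟩
  have e' : ∀ y ∈ Set.Ioi (0 : ℝ), (α * y ^ (α - 1)) * ((-1) ^ (n + 1) * y ^ (2 * n + 1) / (1 + y ^ 2)) =
      (α * (-1) ^ (n + 1)) * (y ^ (α + 2 * n) / (1 + y ^ 2)) := by
    intro y hy
    rw [hpow y hy, Real.rpow_sub_one (ne_of_gt hy)]
    field_simp [ne_of_gt (show (0 : ℝ) < y from hy)]
    ring
  have hlim : ∀ y ∈ Set.Ioi (0 : ℝ), y ^ α * ((-1) ^ (n + 1) * y ^ (2 * n + 1) / (1 + y ^ 2)) =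
      (-1) ^ (n + 1) * (y ^ (α + 2 * n + 1) / (1 + y ^ 2)) := by
    intro y hy
    rw [Real.rpow_add_one (ne_of_gt hy), hpow y hy]
    ring
  have h := integral_Ioi_mul_deriv_eq_deriv_mul (a := (0 : ℝ)) (a' := 0) (b' := 0)
    (u := fun y : ℝ => y ^ α) (u' := fun y => α * y ^ (α - 1))
    (v := fun y : ℝ => (-1) ^ (n + 1) * y ^ (2 * n + 1) / (1 + y ^ 2)) (v' := kernelRemainder n)
    (fun y hy => Real.hasDerivAt_rpow_const (Or.inl (ne_of_gt hy)))
    (fun y _ => hasDerivAt_kernelPrimitive n y) hI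
    ((IntegrableOn.congr_fun (hi.const_mul (α * (-1) ^ (n + 1))) (fun y hy => (e' y hy).symm)
      measurableSet_Ioi)) ?_ ?_
  · rw [h, setIntegral_congr_fun measurableSet_Ioi e', integral_const_mul, hv]
    have r1 := Real.Gamma_mul_Gamma_one_sub ((1 + (α + 2 * n)) / 2)
    have r2 := Real.Gamma_mul_Gamma_one_sub ((α - 1) / 2)
    rw [show 1 - (1 + (α + 2 * n)) / 2 = (1 - (α + 2 * n)) / 2 by ring,
      show Real.pi * ((1 + (α + 2 * n)) / 2) = Real.pi * ((α - 1) / 2) + (n + 1 : ℕ) * Real.pi by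
        push_cast; ring, Real.sin_add_nat_mul_pi] at r1
    rw [show 1 - (α - 1) / 2 = (3 - α) / 2 by ring] at r2
    have r3 : (-1 : ℝ) ^ (n + 1) * (-1) ^ (n + 1) = 1 := by rw [← mul_pow]; simp
    have r4 : Real.pi / ((-1) ^ (n + 1) * Real.sin (Real.pi * ((α - 1) / 2))) =
      (-1) ^ (n + 1) * (Real.pi / Real.sin (Real.pi * ((α - 1) / 2))) := by
      rw [← div_div, div_eq_mul_inv Real.pi, ← inv_pow]
      norm_num
      ring
    rw [r4, ← r2] at r1
    linear_combination (-α / 2 * (-1) ^ (n + 1)) * r1 -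
      α / 2 * Real.Gamma ((3 - α) / 2) * Real.Gamma ((α - 1) / 2) * r3
  · have h0 := (tendsto_rpow_div_one_add_sq_zero (s := α + 2 * n + 1) (by linarith)).const_mul
      ((-1 : ℝ) ^ (n + 1))
    rw [mul_zero] at h0
    exact h0.congr' (by filter_upwards [self_mem_nhdsWithin] with y hy using (hlim y hy).symm)
  · have h0 := (tendsto_rpow_div_one_add_sq_atTop (s := α + 2 * n + 1) (by linarith)).const_mul
      ((-1 : ℝ) ^ (n + 1))
    rw [mul_zero] at h0
    exact h0.congr' (by filter_upwards [eventually_gt_atTop 0] with y hy using (hlim y hy).symm)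

theorem hasSum_inv_sinh_sq {t : ℝ} (ht : 0 < t) :
    HasSum (fun k : ℕ => (1 / (Real.pi * ((k : ℝ) + 1)) ^ 2) * kernelRemainder 0 (t / (Real.pi * (k + 1))))
      (1 / (Real.cosh (2 * t) - 1) - 1 / (2 * t ^ 2)) := by
  set z : ℂ := (t / Real.pi : ℝ) * Complex.I with hz
  have hπ : (Real.pi : ℂ) ≠ 0 := by exact_mod_cast Real.pi_ne_zero
  have htc : (t : ℂ) ≠ 0 := by exact_mod_cast ht.ne'
  have hπz : Real.pi * z = t * Complex.I := by
    rw [hz]; push_cast; field_simp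
  have hzm : z ∈ UpperHalfPlane.upperHalfPlaneSet := by
    change 0 < z.im
    simp [hz]
    positivity
  have hs0 : Real.sinh t ≠ 0 := (Real.sinh_pos_iff.2 ht).ne'
  have hsin : Complex.sin (Real.pi * z) = (Real.sinh t : ℝ) * Complex.I := by
    rw [hπz, Complex.sin_mul_I, Complex.ofReal_sinh]
  have hsin0 : Complex.sin (Real.pi * z) ≠ 0 := by
    rw [hsin]
    exact mul_ne_zero (by exact_mod_cast hs0) Complex.I_ne_zero
  have hd : HasDerivAt (fun x : ℂ => (Real.pi : ℂ) * (Real.pi * x).cot)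
      (-(Real.pi ^ 2 / Complex.sin (Real.pi * z) ^ 2)) z := by
    have h1 : HasDerivAt (fun x : ℂ => (Real.pi : ℂ) * x) Real.pi z := by
      simpa using (hasDerivAt_id z).const_mul (Real.pi : ℂ)
    have h2 := ((h1.ccos.div h1.csin hsin0).const_mul (Real.pi : ℂ))
    refine h2.congr_deriv ?_
    have := Complex.sin_sq_add_cos_sq (Real.pi * z)
    field_simp
    linear_combination -this
  have h := iteratedDerivWithin_cot_pi_mul_eq_mul_tsum_div_pow (le_refl 1) hzm
  rw [iteratedDerivWithin_one, derivWithin_of_isOpen UpperHalfPlane.isOpen_upperHalfPlaneSet hzm,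
    hd.deriv, hsin] at h
  have hsm : Summable fun n : ℤ => 1 / (z + n) ^ 2 := by
    refine (EisensteinSeries.linear_right_summable z 1 (k := 2) le_rfl).congr fun n => ?_
    rw [Int.cast_one, one_mul, one_div]
    norm_cast
  have hS : HasSum (fun n : ℤ => 1 / (z + n) ^ 2) (-(Real.pi ^ 2 / Real.sinh t ^ 2 : ℝ) : ℂ) := by
    have hI : (((Real.sinh t : ℝ) : ℂ) * Complex.I) ^ 2 = -(Real.sinh t : ℂ) ^ 2 := by
      rw [mul_pow, Complex.I_sq]; ring
    rw [hI] at h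
    convert hsm.hasSum using 1
    push_cast at h ⊢
    simp at h ⊢
    linear_combination h
  have h1 := (hasSum_nat_add_iff' 1).2 hS.nat_add_neg
  have h2 := h1.mul_left (-(1 / (2 * Real.pi ^ 2)) : ℂ)
  rw [← Complex.hasSum_ofReal]
  have hz2 : z ^ 2 = -(t / Real.pi : ℝ) ^ 2 := by
    rw [hz, mul_pow, Complex.I_sq]; push_cast; ring
  convert h2 using 1
  · rfl
  · funext k
    set m : ℝ := (k : ℝ) + 1 with hm
    set τ : ℝ := t / Real.pi with hτ
    have hm0 : 0 < m := by positivity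
    have hd0 : ((m : ℂ) ^ 2 + (τ : ℂ) ^ 2) ≠ 0 := by
      exact_mod_cast (by positivity : m ^ 2 + τ ^ 2 ≠ 0)
    have hp : (z + m) * (z - m) = -((m : ℂ) ^ 2 + (τ : ℂ) ^ 2) := by linear_combination hz2
    have ha : z + m ≠ 0 := fun h => hd0 (by rw [h] at hp; linear_combination hp)
    have hb : z - m ≠ 0 := fun h => hd0 (by rw [h] at hp; linear_combination hp)
    have e1 : 1 / (z + m) ^ 2 + 1 / (z - m) ^ 2 =
        2 * ((m : ℂ) ^ 2 - (τ : ℂ) ^ 2) / ((m : ℂ) ^ 2 + (τ : ℂ) ^ 2) ^ 2 := by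
      rw [div_add_div _ _ (pow_ne_zero 2 ha) (pow_ne_zero 2 hb), ← mul_pow, hp, neg_sq]
      congr 1
      linear_combination 2 * hz2
    have e2 : (1 / (Real.pi * m) ^ 2) * kernelRemainder 0 (t / (Real.pi * m)) =
        -(1 / (2 * Real.pi ^ 2)) * (2 * (m ^ 2 - τ ^ 2) / (m ^ 2 + τ ^ 2) ^ 2) := by
      rw [kernelRemainder, hτ]
      have := Real.pi_pos
      field_simp
      ring
    rw [e2]
    push_cast
    rw [← e1, hm]
    push_cast
    ring
  · have hc : Real.cosh (2 * t) - 1 = 2 * Real.sinh t ^ 2 := by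
      rw [Real.cosh_two_mul, Real.cosh_sq]; ring
    rw [hc]
    simp [hz2]
    have := Complex.I_sq
    have hsc : Complex.sinh t ≠ 0 := by rw [← Complex.ofReal_sinh]; exact_mod_cast hs0
    field_simp
    ring

theorem kernelRemainder_zero (y : ℝ) : kernelRemainder 0 y = (y ^ 2 - 1) / (1 + y ^ 2) ^ 2 := by
  simpa using kernelRemainder_eq 0 y

theorem summable_odd_mul_pow {q : ℝ} (h0 : 0 ≤ q) (h1 : q < 1) :
    Summable fun j : ℕ => (2 * (j : ℝ) + 1) * q ^ j := by
  have hq : ‖q‖ < 1 := by rwa [Real.norm_of_nonneg h0]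
  have ha := summable_pow_mul_geometric_of_norm_lt_one 1 hq
  refine ((ha.mul_left 2).add (summable_geometric_of_lt_one h0 h1)).congr fun j => ?_
  rw [pow_one]; ring

theorem hasSum_kernelRemainder_zero {y : ℝ} (hy : y ^ 2 < 1) :
    HasSum (fun j : ℕ => (-1) ^ (j + 1) * (2 * (j : ℝ) + 1) * y ^ (2 * j)) (kernelRemainder 0 y) := by
  have hs := summable_odd_mul_pow (sq_nonneg y) hy
  have hs' : Summable fun j : ℕ => (-1) ^ (j + 1) * (2 * (j : ℝ) + 1) * y ^ (2 * j) := by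
    refine Summable.of_norm (hs.congr fun j => ?_)
    rw [norm_mul, norm_mul, norm_pow, norm_neg, norm_one, one_pow, one_mul, pow_mul,
      Real.norm_of_nonneg (by positivity), Real.norm_of_nonneg (by positivity)]
  have ht : Tendsto (fun n : ℕ => kernelRemainder n y) atTop (nhds 0) := by
    refine squeeze_zero_norm (fun n => ?_) hs.tendsto_atTop_zero
    refine (abs_kernelRemainder_le n y).trans ?_
    rw [← pow_mul]
    gcongr
    refine div_le_self (by rw [pow_mul]; positivity) (by nlinarith [sq_nonneg y])
  have h1 := hs'.hasSum.tendsto_sum_nat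
  have h2 : Tendsto (fun n : ℕ => ∑ j ∈ Finset.range n, (-1) ^ (j + 1) * (2 * (j : ℝ) + 1) * y ^ (2 * j))
      atTop (nhds (kernelRemainder 0 y)) := by
    have := (tendsto_const_nhds (x := kernelRemainder 0 y)).sub ht
    rw [sub_zero] at this
    refine this.congr fun n => ?_
    rw [kernelRemainder_eq n, kernelRemainder_zero]
    ring
  rw [← tendsto_nhds_unique h1 h2]
  exact hs'.hasSum

theorem summable_inv_pi_sq_pow (j : ℕ) :
    Summable fun k : ℕ => (1 / (Real.pi * ((k : ℝ) + 1)) ^ 2) ^ (j + 1) := by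
  refine (summable_pi_rpow (s := -(2 * (j + 1 : ℕ) : ℝ)) (by push_cast; linarith [Nat.cast_nonneg (α := ℝ) j])).congr fun k => ?_
  have : (0 : ℝ) < Real.pi * ((k : ℝ) + 1) := by positivity
  rw [Real.rpow_neg this.le, one_div, inv_pow, ← pow_mul, ← Real.rpow_natCast]
  push_cast
  rfl

theorem laurent_coeff {A : ℕ → ℝ} (hA : IsLaurentA A) (j : ℕ) :
    A (j + 1) * 4 ^ (j + 1) =
      2 * (-1) ^ (j + 1) * (2 * (j : ℝ) + 1) * ∑' k : ℕ, (1 / (Real.pi * ((k : ℝ) + 1)) ^ 2) ^ (j + 1) := by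
  refine congrFun (powerSeries_coeff_unique (r := 1) one_pos
    (a := fun j => A (j + 1) * 4 ^ (j + 1))
    (b := fun j => 2 * (-1) ^ (j + 1) * (2 * (j : ℝ) + 1) *
      ∑' k : ℕ, (1 / (Real.pi * ((k : ℝ) + 1)) ^ 2) ^ (j + 1))
    (f := fun x => 2 * (1 / (Real.cosh (2 * √x) - 1) - 1 / (2 * √x ^ 2))) ?_ ?_) j
  · intro x hx hx1
    have ht : 0 < √x := Real.sqrt_pos.2 hx
    have ht2 : √x ^ 2 = x := Real.sq_sqrt hx.le
    have ht1 : √x < 1 := by rw [Real.sqrt_lt' one_pos]; simpa using hx1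
    have h := (hA.2 (√x) ht.ne' (by
      rw [abs_of_pos ht]; linarith [Real.pi_gt_three])).mul_left (1 / x)
    have hc : Real.cosh (2 * √x) - 1 ≠ 0 := by
      have := Real.one_lt_cosh.2 (by positivity : 2 * √x ≠ 0)
      linarith
    convert h using 1
    · rfl
    · funext i
      rw [pow_mul, mul_pow, ht2, mul_pow, pow_succ x]
      field_simp
      norm_num
    · rw [ht2]
      field_simp
  · intro x hx hx1
    have ht : 0 < √x := Real.sqrt_pos.2 hx
    have ht2 : √x ^ 2 = x := Real.sq_sqrt hx.le
    set c : ℕ → ℝ := fun k => 1 / (Real.pi * ((k : ℝ) + 1)) ^ 2 with hc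
    have hc0 : ∀ k, 0 ≤ c k := fun k => by simp only [hc]; positivity
    have hc1 : ∀ k, c k ≤ 1 := fun k => by
      simp only [hc]
      rw [div_le_one (by positivity)]
      have : 1 ≤ Real.pi * ((k : ℝ) + 1) := by
        nlinarith [Real.pi_gt_three, Nat.cast_nonneg (α := ℝ) k]
      nlinarith
    have hcs : Summable c := by simpa [hc] using summable_inv_pi_sq_pow 0
    set g : ℕ × ℕ → ℝ := fun p => c p.1 * ((-1) ^ (p.2 + 1) * (2 * (p.2 : ℝ) + 1) * (c p.1 * x) ^ p.2) with hg
    have hgs : Summable g := by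
      refine Summable.of_norm_bounded (g := fun p : ℕ × ℕ => c p.1 * ((2 * (p.2 : ℝ) + 1) * x ^ p.2))
        (Summable.mul_of_nonneg hcs (summable_odd_mul_pow hx.le hx1) hc0 (fun j => by
          change 0 ≤ (2 * (j : ℝ) + 1) * x ^ j
          positivity)) fun p => ?_
      simp only [hg]
      have h0 := hc0 p.1
      rw [norm_mul, norm_mul, norm_mul, norm_pow, norm_neg, norm_one, one_pow, one_mul,
        Real.norm_of_nonneg h0, Real.norm_of_nonneg (by positivity), Real.norm_of_nonneg (by positivity)]
      gcongr
      exact mul_le_of_le_one_left hx.le (hc1 _)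
    have hk : ∀ k, HasSum (fun j => g (k, j)) (c k * kernelRemainder 0 (√x / (Real.pi * (k + 1)))) := by
      intro k
      have e : (√x / (Real.pi * ((k : ℝ) + 1))) ^ 2 = c k * x := by
        rw [div_pow, ht2]; simp only [hc]; ring
      refine ((hasSum_kernelRemainder_zero (y := √x / (Real.pi * (k + 1))) ?_).mul_left (c k)).congr_fun
        fun j => ?_
      · rw [e]
        exact (mul_le_of_le_one_left hx.le (hc1 _)).trans_lt hx1
      · simp only [hg]
        rw [pow_mul, e]
    have hj : ∀ j, HasSum (fun k => g (k, j)) ((-1) ^ (j + 1) * (2 * (j : ℝ) + 1) * (∑' k, c k ^ (j + 1)) * x ^ j) := by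
      intro j
      have := ((summable_inv_pi_sq_pow j).hasSum.mul_left ((-1) ^ (j + 1) * (2 * (j : ℝ) + 1) * x ^ j))
      convert this using 1
      · rfl
      · funext k
        simp only [hg, hc]
        ring
      · ring
    have h1 := hgs.hasSum.prod_fiberwise hk
    have h2 := ((Equiv.prodComm ℕ ℕ).hasSum_iff.2 hgs.hasSum).prod_fiberwise hj
    rw [h1.unique (hasSum_inv_sinh_sq ht)] at h2
    refine (h2.mul_left 2).congr_fun fun j => ?_
    ring

theorem hasSum_remainder {A : ℕ → ℝ} (hA : IsLaurentA A) (n : ℕ) {t : ℝ} (ht : 0 < t) :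
    HasSum (fun k : ℕ => (1 / (Real.pi * ((k : ℝ) + 1)) ^ 2) *
      kernelRemainder n (t / (Real.pi * (k + 1))))
      (1 / (Real.cosh (2 * t) - 1) - Lfun A n (2 * t)) := by
  have h1 : HasSum (fun k : ℕ => ∑ j ∈ Finset.range n, ((-1) ^ (j + 1) * (2 * (j : ℝ) + 1) * t ^ (2 * j)) *
      (1 / (Real.pi * ((k : ℝ) + 1)) ^ 2) ^ (j + 1))
      (∑ j ∈ Finset.range n, ((-1) ^ (j + 1) * (2 * (j : ℝ) + 1) * t ^ (2 * j)) *
        ∑' k : ℕ, (1 / (Real.pi * ((k : ℝ) + 1)) ^ 2) ^ (j + 1)) :=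
    hasSum_sum fun j _ => (summable_inv_pi_sq_pow j).hasSum.mul_left _
  have h2 := (hasSum_inv_sinh_sq ht).sub h1
  convert h2 using 1
  · rfl
  · funext k
    rw [kernelRemainder_eq, kernelRemainder_zero, mul_sub, Finset.mul_sum]
    congr 1
    refine Finset.sum_congr rfl fun j _ => ?_
    generalize Real.pi * ((k : ℝ) + 1) = b
    ring
  · rw [sub_sub]
    congr 1
    have e : ∀ j ∈ Finset.range n, A (j + 1) * (2 * t) ^ (2 * (j + 1)) =
        2 * t ^ 2 * (((-1) ^ (j + 1) * (2 * (j : ℝ) + 1) * t ^ (2 * j)) *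
        ∑' k : ℕ, (1 / (Real.pi * ((k : ℝ) + 1)) ^ 2) ^ (j + 1)) := by
      intro j _
      have h := laurent_coeff hA j
      rw [pow_mul, mul_pow, mul_pow]
      norm_num only
      rw [← mul_assoc, h, ← pow_mul]
      ring
    rw [Lfun, Finset.sum_congr rfl e, ← Finset.mul_sum]
    field_simp

theorem rpow_mul_scale {α b t : ℝ} (hb : 0 < b) (ht : 0 < t) (f : ℝ → ℝ) :
    t ^ α * ((1 / b ^ 2) * f (t / b)) = b ^ (α - 2) * ((b⁻¹ * t) ^ α * f (b⁻¹ * t)) := by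
  rw [Real.mul_rpow (by positivity) ht.le, Real.inv_rpow hb.le, Real.rpow_sub hb, Real.rpow_two,
    inv_mul_eq_div]
  field_simp

theorem integral_comp_scale {α b : ℝ} (hb : 0 < b) (f : ℝ → ℝ) :
    ∫ t in Set.Ioi (0 : ℝ), t ^ α * ((1 / b ^ 2) * f (t / b)) =
      b ^ (α - 1) * ∫ y in Set.Ioi (0 : ℝ), y ^ α * f y := by
  have h := integral_comp_mul_left_Ioi (fun y : ℝ => y ^ α * f y) 0 (inv_pos.2 hb)
  rw [mul_zero, inv_inv, smul_eq_mul] at h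
  rw [setIntegral_congr_fun measurableSet_Ioi fun t ht => rpow_mul_scale hb ht f,
    integral_const_mul, h, show α - 1 = (α - 2) + 1 by ring, Real.rpow_add_one hb.ne', mul_assoc]

theorem integrableOn_comp_scale {α b : ℝ} (hb : 0 < b) {f : ℝ → ℝ}
    (hf : IntegrableOn (fun y => y ^ α * f y) (Set.Ioi 0)) :
    IntegrableOn (fun t : ℝ => t ^ α * ((1 / b ^ 2) * f (t / b))) (Set.Ioi 0) := by
  have h := (integrableOn_Ioi_comp_mul_left_iff (fun y : ℝ => y ^ α * f y) 0 (inv_pos.2 hb)).2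
    (by rwa [mul_zero])
  exact IntegrableOn.congr_fun (h.const_mul (b ^ (α - 2)))
    (fun t ht => (rpow_mul_scale hb ht f).symm) measurableSet_Ioi

/-- The limit for negative exponents in closed form. -/
theorem integral_remainder {A : ℕ → ℝ} (hA : IsLaurentA A) {α : ℝ} {n : ℕ}
    (h0 : α < 0) (h1 : -(2 * (n : ℝ) + 1) < α) (h2 : α < -(2 * (n : ℝ) - 1)) :
    ∫ t in Set.Ioi (0 : ℝ), (t ^ α / (Real.cosh (2 * t) - 1) - t ^ α * Lfun A n (2 * t)) =
      -α / 2 * Real.Gamma ((3 - α) / 2) * Real.Gamma ((α - 1) / 2) *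
        ∑' k : ℕ, (Real.pi * ((k : ℝ) + 1)) ^ (α - 1) := by
  obtain ⟨hI, hv⟩ := integral_rpow_mul_kernelRemainder h1 h2
  have hb : ∀ k : ℕ, 0 < Real.pi * ((k : ℝ) + 1) := fun k => by positivity
  have hnorm : ∀ k : ℕ, ∫ t in Set.Ioi (0 : ℝ), ‖t ^ α * ((1 / (Real.pi * ((k : ℝ) + 1)) ^ 2) *
      kernelRemainder n (t / (Real.pi * (k + 1))))‖ = (Real.pi * ((k : ℝ) + 1)) ^ (α - 1) *
        ∫ y in Set.Ioi (0 : ℝ), y ^ α * |kernelRemainder n y| := by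
    intro k
    rw [← integral_comp_scale (hb k) (fun y => |kernelRemainder n y|)]
    refine setIntegral_congr_fun measurableSet_Ioi fun t ht => ?_
    have ht : 0 < t := ht
    simp only [norm_mul, Real.norm_eq_abs]
    rw [abs_of_nonneg (by positivity : 0 ≤ t ^ α), abs_of_nonneg (by positivity :
      0 ≤ 1 / (Real.pi * ((k : ℝ) + 1)) ^ 2)]
  have h := hasSum_integral_of_summable_integral_norm (fun k : ℕ => integrableOn_comp_scale (hb k) hI) (by
    simp only [hnorm]
    exact (summable_pi_rpow (by linarith)).mul_right _)
  have e : ∀ t ∈ Set.Ioi (0 : ℝ), ∑' k : ℕ, t ^ α * ((1 / (Real.pi * ((k : ℝ) + 1)) ^ 2) *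
      kernelRemainder n (t / (Real.pi * (k + 1)))) =
      t ^ α / (Real.cosh (2 * t) - 1) - t ^ α * Lfun A n (2 * t) := by
    intro t ht
    rw [tsum_mul_left, (hasSum_remainder hA n ht).tsum_eq]
    ring
  rw [← setIntegral_congr_fun measurableSet_Ioi e, ← h.tsum_eq, ← hv, ← tsum_mul_left]
  refine tsum_congr fun k => ?_
  rw [integral_comp_scale (hb k), mul_comm]

theorem Gamma_half_ne_zero {α : ℝ} {n : ℕ} (h1 : -(2 * (n : ℝ) + 1) < α)
    (h2 : α < -(2 * (n : ℝ) - 1)) : Real.Gamma ((α - 1) / 2) ≠ 0 := by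
  refine Real.Gamma_ne_zero fun m hm => ?_
  have a1 : (m : ℝ) < n + 1 := by linarith
  have a2 : (n : ℝ) < m := by linarith
  norm_cast at a1 a2
  omega

theorem limit_eq_of_neg {L : ℝ} {A : ℕ → ℝ} (hA : IsLaurentA A) {α : ℝ} {n : ℕ}
    (hm : AEStronglyMeasurable (limitExcess L) (volume.restrict (Set.Ioi 0)))
    (hb : ∀ p : ℕ, ∃ C, 0 ≤ C ∧ RapidBound C p (limitExcess L))
    (h0 : α < 0) (h1 : -(2 * (n : ℝ) + 1) < α) (h2 : α < -(2 * (n : ℝ) - 1)) :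
    L - α * ∫ y in Set.Ioi (0 : ℝ), y ^ (α - 1) * limitExcess L y =
      (∫ t in Set.Ioi (0 : ℝ), (t ^ α / (Real.cosh (2 * t) - 1) - t ^ α * Lfun A n (2 * t))) /
        Real.Gamma ((α - 1) / 2) := by
  rw [limit_of_neg h0 hm hb, integral_remainder hA h0 h1 h2, eq_div_iff (Gamma_half_ne_zero h1 h2)]
  ring

/-- `1 / (cosh 2t - 1)` with its singularity at `0` removed by a Gaussian. -/
noncomputable def smoothedKernel (t : ℝ) : ℝ :=
  1 / (Real.cosh (2 * t) - 1) - Real.exp (-t ^ 2) / (2 * t ^ 2)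

theorem cosh_two_mul_sub_one_pos {t : ℝ} (ht : 0 < t) : 0 < Real.cosh (2 * t) - 1 := by
  have := Real.one_lt_cosh.2 (by positivity : 2 * t ≠ 0)
  linarith

theorem abs_one_sub_exp_le {x : ℝ} (hx : 0 ≤ x) :
    |Real.exp (-x) - 1| ≤ 2 * x / (1 + x) := by
  have h1 : Real.exp (-x) ≤ 1 := Real.exp_le_one_iff.2 (by linarith)
  have h2 := Real.add_one_le_exp (-x)
  have h3 := Real.exp_pos (-x)
  rw [abs_of_nonpos (by linarith), le_div_iff₀ (by positivity)]
  rcases le_total x 1 with h | h <;> nlinarith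

theorem smoothedKernel_bound : ∃ C, 0 ≤ C ∧ ∀ t, 0 < t → |smoothedKernel t| ≤ C * Real.exp (-t) := by
  set S := ∑' k : ℕ, 1 / (Real.pi * ((k : ℝ) + 1)) ^ 2 with hS
  have hs : Summable fun k : ℕ => 1 / (Real.pi * ((k : ℝ) + 1)) ^ 2 := by
    simpa using summable_inv_pi_sq_pow 0
  have hS0 : 0 ≤ S := tsum_nonneg fun k => by positivity
  have hE := Real.exp_pos 1
  refine ⟨(S + 1) * Real.exp 1 + 5, by positivity, fun t ht => ?_⟩
  have het := Real.exp_pos (-t)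
  rcases le_total t 1 with h | h
  · have h1 : |1 / (Real.cosh (2 * t) - 1) - 1 / (2 * t ^ 2)| ≤ S := by
      have hh := hasSum_inv_sinh_sq ht
      rw [← hh.tsum_eq, ← Real.norm_eq_abs]
      refine tsum_of_norm_bounded hs.hasSum fun k => ?_
      rw [norm_mul, Real.norm_of_nonneg (by positivity)]
      refine mul_le_of_le_one_right (by positivity) ((abs_kernelRemainder_le 0 _).trans ?_)
      simp only [Nat.cast_zero, mul_zero, zero_add, pow_zero, one_mul]
      rw [div_le_one (by positivity)]
      nlinarith [sq_nonneg (t / (Real.pi * (k + 1)))]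
    have h2 : |(Real.exp (-t ^ 2) - 1) / (2 * t ^ 2)| ≤ 1 := by
      have := abs_one_sub_exp_le (sq_nonneg t)
      rw [abs_div, abs_of_pos (by positivity : 0 < 2 * t ^ 2), div_le_one (by positivity)]
      exact this.trans (div_le_self (by positivity) (by nlinarith))
    have e : smoothedKernel t = (1 / (Real.cosh (2 * t) - 1) - 1 / (2 * t ^ 2)) -
        (Real.exp (-t ^ 2) - 1) / (2 * t ^ 2) := by
      rw [smoothedKernel]; ring
    have h3 : 1 ≤ Real.exp 1 * Real.exp (-t) := by
      rw [← Real.exp_add]; exact Real.one_le_exp (by linarith)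
    rw [e]
    refine (abs_sub _ _).trans ?_
    nlinarith
  · have h1 : 1 / (Real.cosh (2 * t) - 1) ≤ 4 * Real.exp (-t) := by
      rw [div_le_iff₀ (cosh_two_mul_sub_one_pos ht), Real.cosh_eq]
      have h2 : 1 + t ≤ Real.exp t := by linarith [Real.add_one_le_exp t]
      have h3 : Real.exp (2 * t) = Real.exp t * Real.exp t := by rw [← Real.exp_add]; ring_nf
      have h4 : Real.exp (-t) * Real.exp t = 1 := by rw [← Real.exp_add]; simp
      have h5 := Real.exp_pos (-(2 * t))
      rw [h3]
      have h6 : Real.exp (-t) ≤ 1 / 2 := by nlinarith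
      have h7 : 4 * Real.exp (-t) * ((Real.exp t * Real.exp t + Real.exp (-(2 * t))) / 2 - 1) =
        2 * (Real.exp (-t) * Real.exp t) * Real.exp t + 2 * Real.exp (-t) * Real.exp (-(2 * t)) -
          4 * Real.exp (-t) := by ring
      rw [h7, h4]
      nlinarith [mul_pos het h5]
    have h2 : Real.exp (-t ^ 2) / (2 * t ^ 2) ≤ Real.exp (-t) := by
      rw [div_le_iff₀ (by positivity)]
      have : Real.exp (-t ^ 2) ≤ Real.exp (-t) := Real.exp_le_exp.2 (by nlinarith)
      refine this.trans (le_mul_of_one_le_right het.le ?_)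
      nlinarith
    have h3 : 0 ≤ 1 / (Real.cosh (2 * t) - 1) := (one_div_pos.2 (cosh_two_mul_sub_one_pos ht)).le
    have h4 : 0 ≤ Real.exp (-t ^ 2) / (2 * t ^ 2) := by positivity
    have h5 : 0 ≤ (S + 1) * Real.exp 1 * Real.exp (-t) := by positivity
    rw [smoothedKernel]
    exact abs_le.2 ⟨by nlinarith, by nlinarith⟩

theorem continuousOn_smoothedKernel : ContinuousOn smoothedKernel (Set.Ioi 0) := by
  unfold smoothedKernel
  refine ContinuousOn.sub (ContinuousOn.div continuousOn_const (by fun_prop) fun t ht =>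
    (cosh_two_mul_sub_one_pos ht).ne') (ContinuousOn.div (by fun_prop) (by fun_prop) fun t ht => ?_)
  have : 0 < t := ht
  positivity

theorem integrableOn_rpow_mul_smoothedKernel {α : ℝ} (hα : -1 < α) :
    IntegrableOn (fun t => t ^ α * smoothedKernel t) (Set.Ioi 0) := by
  obtain ⟨C, hC, h⟩ := smoothedKernel_bound
  have hG := Real.GammaIntegral_convergent (s := α + 1) (by linarith)
  refine Integrable.mono' (Integrable.const_mul hG C) ?_ ?_
  · refine ContinuousOn.aestronglyMeasurable (ContinuousOn.mul (fun t ht => ?_)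
      continuousOn_smoothedKernel) measurableSet_Ioi
    exact (Real.continuousAt_rpow_const _ _ (Or.inl (ne_of_gt ht))).continuousWithinAt
  · filter_upwards [ae_restrict_mem measurableSet_Ioi] with t ht
    have ht : 0 < t := ht
    rw [norm_mul, Real.norm_of_nonneg (by positivity), add_sub_cancel_right, Real.norm_eq_abs]
    calc _ ≤ t ^ α * (C * Real.exp (-t)) := by gcongr; exact h t ht
      _ = _ := by ring

theorem differentiableAt_mellin_smoothedKernel {s : ℂ} (hs : 0 < s.re) :
    DifferentiableAt ℂ (mellin fun t => (smoothedKernel t : ℂ)) s := by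
  obtain ⟨C, hC, h⟩ := smoothedKernel_bound
  refine mellin_differentiableAt_of_isBigO_rpow_exp (a := 1) (b := 0) one_pos ?_ ?_ ?_ hs
  · exact (Complex.continuous_ofReal.comp_continuousOn continuousOn_smoothedKernel).locallyIntegrableOn
      measurableSet_Ioi
  · refine Asymptotics.IsBigO.of_bound C ?_
    filter_upwards [eventually_gt_atTop 0] with t ht
    rw [Complex.norm_real, Real.norm_eq_abs, Real.norm_of_nonneg (Real.exp_pos _).le, neg_one_mul]
    exact h t ht
  · refine Asymptotics.IsBigO.of_bound C ?_
    filter_upwards [self_mem_nhdsWithin] with t ht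
    have ht : 0 < t := ht
    rw [Complex.norm_real, Real.norm_eq_abs, neg_zero, Real.rpow_zero, norm_one]
    refine (h t ht).trans ?_
    gcongr
    exact Real.exp_le_one_iff.2 (by linarith)

theorem mellin_ofReal_eq (f : ℝ → ℝ) (α : ℝ) :
    mellin (fun t => (f t : ℂ)) (α : ℂ) = ((∫ t in Set.Ioi (0 : ℝ), t ^ (α - 1) * f t : ℝ) : ℂ) := by
  rw [mellin, ← integral_complex_ofReal]
  refine setIntegral_congr_fun measurableSet_Ioi fun t ht => ?_
  have ht : 0 < t := ht
  simp only [smul_eq_mul]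
  push_cast [Complex.ofReal_cpow ht.le]
  rfl

theorem integral_rpow_div_cosh {α : ℝ} (hα : 1 < α) :
    ∫ t in Set.Ioi (0 : ℝ), t ^ α / (Real.cosh (2 * t) - 1) =
      (∫ t in Set.Ioi (0 : ℝ), t ^ α * smoothedKernel t) + 1 / 4 * Real.Gamma ((α - 1) / 2) := by
  have h := integral_rpow_mul_exp_neg_rpow two_pos (q := α - 2) (by linarith)
  have hi := integrableOn_rpow_mul_exp_neg_rpow (s := α - 2) (by linarith) two_pos
  rw [show (α - 2 + 1) / 2 = (α - 1) / 2 by ring] at h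
  rw [show 1 / 4 * Real.Gamma ((α - 1) / 2) = 1 / 2 * (1 / 2 * Real.Gamma ((α - 1) / 2)) by ring, ← h,
    ← integral_const_mul, ← integral_add (integrableOn_rpow_mul_smoothedKernel (by linarith))
    (Integrable.const_mul hi _)]
  refine setIntegral_congr_fun measurableSet_Ioi fun t ht => ?_
  have ht : 0 < t := ht
  simp only [smoothedKernel]
  rw [Real.rpow_sub ht, Real.rpow_two]
  ring

theorem integral_rpow_mul_exp_sub_one {α : ℝ} (h1 : -1 < α) (h2 : α < 1) :
    IntegrableOn (fun t : ℝ => (Real.exp (-t ^ 2) - 1) * t ^ (α - 2)) (Set.Ioi 0) ∧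
    ∫ t in Set.Ioi (0 : ℝ), (Real.exp (-t ^ 2) - 1) * t ^ (α - 2) =
      1 / 2 * Real.Gamma ((α - 1) / 2) := by
  have hα : α - 1 ≠ 0 := by linarith
  have hb : ∀ t : ℝ, |Real.exp (-t ^ 2) - 1| ≤ 2 * t ^ 2 / (1 + t ^ 2) := fun t =>
    abs_one_sub_exp_le (sq_nonneg t)
  have hI : IntegrableOn (fun t : ℝ => (Real.exp (-t ^ 2) - 1) * t ^ (α - 2)) (Set.Ioi 0) := by
    refine Integrable.mono' ((integral_rpow_div_one_add_sq h1 h2).1.const_mul 2)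
      (Measurable.aestronglyMeasurable (by fun_prop)) ?_
    filter_upwards [ae_restrict_mem measurableSet_Ioi] with t ht
    have ht : 0 < t := ht
    rw [norm_mul, Real.norm_of_nonneg (by positivity : 0 ≤ t ^ (α - 2)), Real.norm_eq_abs]
    calc _ ≤ 2 * t ^ 2 / (1 + t ^ 2) * t ^ (α - 2) := by gcongr; exact hb t
      _ = _ := by rw [Real.rpow_sub ht, Real.rpow_two]; field_simp
  refine ⟨hI, ?_⟩
  have hv : ∀ t ∈ Set.Ioi (0 : ℝ), HasDerivAt (fun t : ℝ => t ^ (α - 1) / (α - 1)) (t ^ (α - 2)) t := by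
    intro t ht
    have h := (Real.hasDerivAt_rpow_const (p := α - 1) (Or.inl (ne_of_gt ht))).div_const (α - 1)
    refine h.congr_deriv ?_
    rw [mul_div_cancel_left₀ _ hα]
    congr 1; ring
  have hu : ∀ t ∈ Set.Ioi (0 : ℝ), HasDerivAt (fun t : ℝ => Real.exp (-t ^ 2) - 1)
      (-(2 * t) * Real.exp (-t ^ 2)) t := by
    intro t _
    have h := ((hasDerivAt_pow 2 t).neg.exp).sub_const 1
    refine h.congr_deriv ?_
    simp
    ring
  have hG := integral_rpow_mul_exp_neg_rpow two_pos h1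
  have hGi := integrableOn_rpow_mul_exp_neg_rpow h1 two_pos
  have e : ∀ t ∈ Set.Ioi (0 : ℝ), (-(2 * t) * Real.exp (-t ^ 2)) * (t ^ (α - 1) / (α - 1)) =
      -2 / (α - 1) * (t ^ α * Real.exp (-t ^ (2 : ℝ))) := by
    intro t ht
    have ht : 0 < t := ht
    rw [Real.rpow_sub_one ht.ne', Real.rpow_two]
    field_simp
  have hbd : ∀ t : ℝ, 0 < t → |(Real.exp (-t ^ 2) - 1) * (t ^ (α - 1) / (α - 1))| ≤
      2 / |α - 1| * (t ^ (α + 1) / (1 + t ^ 2)) := by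
    intro t ht
    rw [abs_mul, abs_div, abs_of_nonneg (by positivity : 0 ≤ t ^ (α - 1))]
    calc _ ≤ 2 * t ^ 2 / (1 + t ^ 2) * (t ^ (α - 1) / |α - 1|) := by gcongr; exact hb t
      _ = _ := by
        rw [show α + 1 = (α - 1) + (2 : ℕ) by push_cast; ring, Real.rpow_add ht, Real.rpow_natCast]
        ring
  have h := integral_Ioi_mul_deriv_eq_deriv_mul (a := (0 : ℝ)) (a' := 0) (b' := 0) hu hv hI
    (IntegrableOn.congr_fun (hGi.const_mul _) (fun t ht => (e t ht).symm) measurableSet_Ioi) ?_ ?_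
  · rw [h, setIntegral_congr_fun measurableSet_Ioi e, integral_const_mul, hG,
      show (α + 1) / 2 = (α - 1) / 2 + 1 by ring, Real.Gamma_add_one (div_ne_zero hα two_ne_zero)]
    field_simp
    ring
  · refine squeeze_zero_norm' ?_ (by
      simpa using (tendsto_rpow_div_one_add_sq_zero (s := α + 1) (by linarith)).const_mul (2 / |α - 1|))
    filter_upwards [self_mem_nhdsWithin] with t ht using hbd t ht
  · refine squeeze_zero_norm' ?_ (by
      simpa using (tendsto_rpow_div_one_add_sq_atTop (s := α + 1) (by linarith)).const_mul (2 / |α - 1|))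
    filter_upwards [eventually_gt_atTop 0] with t ht using hbd t ht

theorem integral_rpow_regularized (A : ℕ → ℝ) {α : ℝ} (h1 : -1 < α) (h2 : α < 1) :
    ∫ t in Set.Ioi (0 : ℝ), (t ^ α / (Real.cosh (2 * t) - 1) - t ^ α * Lfun A 0 (2 * t)) =
      (∫ t in Set.Ioi (0 : ℝ), t ^ α * smoothedKernel t) + 1 / 4 * Real.Gamma ((α - 1) / 2) := by
  obtain ⟨hi, h⟩ := integral_rpow_mul_exp_sub_one h1 h2
  rw [show 1 / 4 * Real.Gamma ((α - 1) / 2) = 1 / 2 * (1 / 2 * Real.Gamma ((α - 1) / 2)) by ring, ← h,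
    ← integral_const_mul, ← integral_add (integrableOn_rpow_mul_smoothedKernel h1)
    (Integrable.const_mul hi _)]
  refine setIntegral_congr_fun measurableSet_Ioi fun t ht => ?_
  have ht : 0 < t := ht
  simp only [smoothedKernel, Lfun, Finset.range_zero, Finset.sum_empty]
  rw [Real.rpow_sub ht, Real.rpow_two]
  field_simp
  ring

theorem differentiable_mellin_limitExcess {L : ℝ}
    (hm : AEStronglyMeasurable (limitExcess L) (volume.restrict (Set.Ioi 0)))
    (hb : ∀ p : ℕ, ∃ C, 0 ≤ C ∧ RapidBound C p (limitExcess L)) :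
    Differentiable ℂ (mellin fun y => (limitExcess L y : ℂ)) := by
  intro s
  obtain ⟨p, hp⟩ := exists_nat_gt |s.re|
  obtain ⟨C, -, h0, h1⟩ := hb p
  have hi : IntegrableOn (limitExcess L) (Set.Ioi 0) := by
    simpa using integrableOn_rpow_mul_excess 1 hm hb
  refine mellin_differentiableAt_of_isBigO_rpow (a := p) (b := -p) ?_ ?_
    (lt_of_abs_lt hp) ?_ (abs_lt.1 hp).1
  · have hc : IntegrableOn (fun y => (limitExcess L y : ℂ)) (Set.Ioi 0) := Integrable.ofReal hi
    exact hc.locallyIntegrableOn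
  · refine Asymptotics.IsBigO.of_bound C ?_
    filter_upwards [eventually_gt_atTop 1] with y hy
    have hy0 : 0 < y := one_pos.trans hy
    rw [Complex.norm_real, Real.norm_eq_abs, Real.norm_of_nonneg (by positivity),
      Real.rpow_neg hy0.le, Real.rpow_natCast, ← inv_pow, ← one_div]
    exact h1 y hy
  · refine Asymptotics.IsBigO.of_bound C ?_
    filter_upwards [Ioc_mem_nhdsGT one_pos] with y hy
    have hy0 : 0 < y := hy.1
    rw [Complex.norm_real, Real.norm_eq_abs, Real.norm_of_nonneg (by positivity), neg_neg,
      Real.rpow_natCast]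
    exact h0 y hy.1 hy.2

/-- The difference of the two analytic expressions for the limiting constant, as a function of a
complex exponent. -/
noncomputable def limitDefect (L : ℝ) (z : ℂ) : ℂ :=
  L - z * mellin (fun y => (limitExcess L y : ℂ)) z - 1 / 4 -
    mellin (fun t => (smoothedKernel t : ℂ)) (z + 1) * (Complex.Gamma ((z - 1) / 2))⁻¹

theorem limitDefect_ofReal (L α : ℝ) :
    limitDefect L α = ((L - α * (∫ y in Set.Ioi (0 : ℝ), y ^ (α - 1) * limitExcess L y) - 1 / 4 -
      (∫ t in Set.Ioi (0 : ℝ), t ^ α * smoothedKernel t) * (Real.Gamma ((α - 1) / 2))⁻¹ : ℝ) : ℂ) := by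
  have h1 : ((α : ℂ) + 1) = ((α + 1 : ℝ) : ℂ) := by push_cast; rfl
  have h2 : ((α : ℂ) - 1) / 2 = (((α - 1) / 2 : ℝ) : ℂ) := by push_cast; rfl
  rw [limitDefect, h1, h2, mellin_ofReal_eq, mellin_ofReal_eq, Complex.Gamma_ofReal,
    add_sub_cancel_right]
  push_cast
  rfl

theorem analyticOnNhd_limitDefect {L : ℝ}
    (hm : AEStronglyMeasurable (limitExcess L) (volume.restrict (Set.Ioi 0)))
    (hb : ∀ p : ℕ, ∃ C, 0 ≤ C ∧ RapidBound C p (limitExcess L)) :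
    AnalyticOnNhd ℂ (limitDefect L) {z | -1 < z.re} := by
  refine DifferentiableOn.analyticOnNhd (fun z hz => ?_)
    (isOpen_lt continuous_const Complex.continuous_re)
  have hz : -1 < z.re := hz
  refine DifferentiableAt.differentiableWithinAt ?_
  have h1 := differentiable_mellin_limitExcess hm hb z
  have h2 : DifferentiableAt ℂ (fun z : ℂ => mellin (fun t => (smoothedKernel t : ℂ)) (z + 1)) z :=
    DifferentiableAt.comp (f := fun z : ℂ => z + 1) z
      (differentiableAt_mellin_smoothedKernel (by simp; linarith)) (by fun_prop)
  have h3 : DifferentiableAt ℂ (fun z : ℂ => (Complex.Gamma ((z - 1) / 2))⁻¹) z :=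
    DifferentiableAt.comp (f := fun z : ℂ => (z - 1) / 2) z
      (Complex.differentiable_one_div_Gamma _) (by fun_prop)
  exact (((differentiableAt_const _).sub (differentiableAt_id.mul h1)).sub
    (differentiableAt_const _)).sub (h2.mul h3)

theorem limit_eq_of_gt {L : ℝ} {A : ℕ → ℝ} (hA : IsLaurentA A) {α : ℝ}
    (hm : AEStronglyMeasurable (limitExcess L) (volume.restrict (Set.Ioi 0)))
    (hb : ∀ p : ℕ, ∃ C, 0 ≤ C ∧ RapidBound C p (limitExcess L)) (hα : -1 < α) :
    L - α * ∫ y in Set.Ioi (0 : ℝ), y ^ (α - 1) * limitExcess L y =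
      1 / 4 + (∫ t in Set.Ioi (0 : ℝ), t ^ α * smoothedKernel t) *
        (Real.Gamma ((α - 1) / 2))⁻¹ := by
  have hneg : ∀ β : ℝ, -1 < β → β < 0 → limitDefect L β = 0 := by
    intro β h1 h2
    have h1' : -(2 * ((0 : ℕ) : ℝ) + 1) < β := by simpa using h1
    have h2' : β < -(2 * ((0 : ℕ) : ℝ) - 1) := by simp; linarith
    have hG := Gamma_half_ne_zero h1' h2'
    rw [limitDefect_ofReal, limit_eq_of_neg hA hm hb h2 h1' h2',
      integral_rpow_regularized A h1 (by linarith)]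
    norm_cast
    field_simp
    ring
  have hpre : IsPreconnected {z : ℂ | -1 < z.re} := (convex_halfSpace_re_gt (-1)).isPreconnected
  have htend : Tendsto (fun n : ℕ => ((-1 / 2 + 1 / ((n : ℝ) + 3) : ℝ) : ℂ)) atTop
      (nhdsWithin ((-1 / 2 : ℝ) : ℂ) {((-1 / 2 : ℝ) : ℂ)}ᶜ) := by
    refine tendsto_nhdsWithin_iff.2 ⟨?_, Eventually.of_forall fun n => ?_⟩
    · refine (Complex.continuous_ofReal.tendsto _).comp ?_
      have h := (tendsto_const_nhds (x := (-1 / 2 : ℝ))).add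
        ((tendsto_one_div_add_atTop_nhds_zero_nat (𝕜 := ℝ)).comp (tendsto_add_atTop_nat 2))
      rw [add_zero] at h
      refine h.congr fun n => ?_
      simp only [Function.comp_apply]
      push_cast
      ring
    · have : (0 : ℝ) < 1 / ((n : ℝ) + 3) := by positivity
      simp only [Set.mem_compl_iff, Set.mem_singleton_iff, Complex.ofReal_inj]
      linarith
  have hfreq : ∃ᶠ z in nhdsWithin ((-1 / 2 : ℝ) : ℂ) {((-1 / 2 : ℝ) : ℂ)}ᶜ, limitDefect L z = 0 := by
    refine htend.frequently (Eventually.of_forall fun n => ?_).frequently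
    have h0 : (0 : ℝ) < 1 / ((n : ℝ) + 3) := by positivity
    have h1 : 1 / ((n : ℝ) + 3) ≤ 1 / 3 :=
      one_div_le_one_div_of_le (by norm_num) (by linarith [n.cast_nonneg (α := ℝ)])
    exact hneg _ (by linarith) (by linarith)
  have hzero := (analyticOnNhd_limitDefect hm hb).eqOn_zero_of_preconnected_of_frequently_eq_zero
    hpre (by simp; norm_num) hfreq (show (α : ℂ) ∈ {z : ℂ | -1 < z.re} by simpa using hα)
  rw [limitDefect_ofReal] at hzero
  have h := Complex.ofReal_eq_zero.1 hzero
  linarith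

/-- Proposition 3.4 (generic case): for `α > 1` or `−(2n+1) < α < −(2n−1)`, the Taylor
coefficients satisfy `Z_N = C_α N^{(α−3)/2} 4^N (1 + o(1))` with
`C_α = c_α/Γ((α−1)/2)`, where `c_α = ∫₀^∞ t^α/(cosh 2t − 1) dt` for `α > 1` and
`c_α = ∫₀^∞ (t^α/(cosh 2t − 1) − t^α L_n(2t)) dt` in the second case. -/
theorem coefficient_asymptotics (α : ℝ) (A : ℕ → ℝ) (hA : IsLaurentA A)
    (Z : ℕ → ℝ) (hZ : IsCoeffSeq α Z) :
    (1 < α →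
      Tendsto (fun N : ℕ => Z N / ((N : ℝ) ^ ((α - 3) / 2) * 4 ^ N)) atTop
        (nhds ((∫ t in Set.Ioi (0 : ℝ), (t ^ α / (Real.cosh (2 * t) - 1)) : ℝ) /
          Real.Gamma ((α - 1) / 2)))) ∧
    (∀ n : ℕ, -(2 * (n : ℝ) + 1) < α → α < -(2 * (n : ℝ) - 1) →
      Tendsto (fun N : ℕ => Z N / ((N : ℝ) ^ ((α - 3) / 2) * 4 ^ N)) atTop
        (nhds ((∫ t in Set.Ioi (0 : ℝ),
            (t ^ α / (Real.cosh (2 * t) - 1) - t ^ α * Lfun A n (2 * t)) : ℝ) /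
          Real.Gamma ((α - 1) / 2)))) := by
  obtain ⟨L, hm, hb, hT⟩ := exists_limit
  have hlim := hT α Z hZ
  refine ⟨fun hα => ?_, fun n h1 h2 => ?_⟩
  · have hG : Real.Gamma ((α - 1) / 2) ≠ 0 := (Real.Gamma_pos_of_pos (by linarith)).ne'
    rw [limit_eq_of_gt hA hm hb (by linarith)] at hlim
    rw [integral_rpow_div_cosh hα, add_div, mul_div_cancel_right₀ _ hG, add_comm, div_eq_mul_inv _
      (Real.Gamma _)]
    exact hlim
  · have hG := Gamma_half_ne_zero h1 h2
    rcases n.eq_zero_or_pos with rfl | hn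
    · have h1' : -1 < α := by simpa using h1
      have h2' : α < 1 := by simpa using h2
      rw [limit_eq_of_gt hA hm hb h1'] at hlim
      rw [integral_rpow_regularized A h1' h2', add_div, mul_div_cancel_right₀ _ hG, add_comm,
        div_eq_mul_inv _ (Real.Gamma _)]
      exact hlim
    · have hn1 : (1 : ℝ) ≤ n := by exact_mod_cast hn
      rw [limit_eq_of_neg hA hm hb (by linarith) h1 h2] at hlim
      exact hlim
end
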